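/- arXiv:2405.05375 — 2 statements merged into one kernel-verified Lean document; each statement's English description precedes it below -/
import Mathlib

section
/- Every leafy graph of a cycle is arithmetic antimagic and arithmetic product antimagic. -/
open scoped Classical

noncomputable def edgeFS {V : Type*} [Fintype V] (G : SimpleGraph V) : Finset (Sym2 V) :=
  G.edgeSet.toFinset

noncomputable def vSum {V : Type*} [Fintype V] (G : SimpleGraph V) (φ : Sym2 V → ℝ) (v : V) : ℝ :=
  ∑ e ∈ (edgeFS G).filter (fun e => v ∈ e), φ e

noncomputable def vProd {V : Type*} [Fintype V] (G : SimpleGraph V) (φ : Sym2 V → ℝ) (v : V) : ℝ :=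
  ∏ e ∈ (edgeFS G).filter (fun e => v ∈ e), φ e

/-- `G` admits an antimagic `L`-labeling for every strictly increasing arithmetic
sequence `L` of positive reals of length `(edgeFS G).card`. -/
def ArithAntimagic {V : Type*} [Fintype V] (G : SimpleGraph V) : Prop :=
  ∀ a d : ℝ, 0 < a → 0 < d →
    ∃ φ : Sym2 V → ℝ,
      Set.BijOn φ ↑(edgeFS G)
        ↑((Finset.range (edgeFS G).card).image (fun i : ℕ => a + (i : ℝ) * d)) ∧
      Function.Injective (vSum G φ)

/-- `G` admits a product antimagic `L`-labeling for every strictly increasing arithmetic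
sequence `L` of reals, all at least `1`, of length `(edgeFS G).card`. -/
def ArithProdAntimagic {V : Type*} [Fintype V] (G : SimpleGraph V) : Prop :=
  ∀ a d : ℝ, 1 ≤ a → 0 < d →
    ∃ φ : Sym2 V → ℝ,
      Set.BijOn φ ↑(edgeFS G)
        ↑((Finset.range (edgeFS G).card).image (fun i : ℕ => a + (i : ℝ) * d)) ∧
      Function.Injective (vProd G φ)

/-- `G'` is a leafy graph of `G`: `G'` is obtained from `G` by attaching a non-negative
number of new pendant edges (new leaves) to each interior vertex (degree at least two)
of `G`. -/
def IsLeafyGraphOf {V V' : Type*} [Fintype V] [Fintype V'] (G' : SimpleGraph V')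
    (G : SimpleGraph V) : Prop :=
  ∃ f : V ↪ V',
    (∀ u v : V, G'.Adj (f u) (f v) ↔ G.Adj u v) ∧
    (∀ x : V', x ∉ Set.range f →
      G'.degree x = 1 ∧ ∃ v : V, G'.Adj x (f v) ∧ 2 ≤ G.degree v)

/-- The properties of the value of the `i`-th label that the construction uses: they hold for
arithmetic progressions of positive reals and for logarithms of arithmetic progressions of reals
at least one. -/
structure Admissible (g : ℕ → ℝ) : Prop where
  mono : StrictMono g
  nonneg : ∀ i, 0 ≤ g i
  add_lt_add_three : ∀ b t y z l, b < l → b < y + z → b + t ≤ y + z + l →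
    g b + g t < g y + g z + g l
  add_lt_add_two : ∀ b t y z, b < y → b < z → b + t < y + z → g b + g t < g y + g z
  superadd : ∀ y l, 1 ≤ y → 1 ≤ l → g (y + l) < g y + g l

theorem admissible_linear {a d : ℝ} (ha : 0 < a) (hd : 0 < d) :
    Admissible (fun i : ℕ => a + (i : ℝ) * d) where
  mono := fun i j h => by
    have : (i : ℝ) < j := by exact_mod_cast h
    simp only
    nlinarith
  nonneg := fun i => by positivity
  add_lt_add_three := fun b t y z l _ _ h => by
    have h' : (b : ℝ) + t ≤ y + z + l := by exact_mod_cast h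
    nlinarith
  add_lt_add_two := fun b t y z _ _ h => by
    have h' : (b : ℝ) + t < y + z := by exact_mod_cast h
    nlinarith
  superadd := fun y l _ _ => by
    push_cast
    nlinarith

theorem admissible_log {a d : ℝ} (ha : 1 ≤ a) (hd : 0 < d) :
    Admissible (fun i : ℕ => Real.log (a + (i : ℝ) * d)) := by
  have hpos : ∀ i : ℕ, 0 < a + (i : ℝ) * d := fun i => by positivity
  have hle : ∀ i : ℕ, 1 ≤ a + (i : ℝ) * d := fun i => by
    have : 0 ≤ (i : ℝ) * d := by positivity
    linarith
  refine ⟨?_, fun i => Real.log_nonneg (hle i), ?_, ?_, ?_⟩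
  · intro i j h
    have : (i : ℝ) < j := by exact_mod_cast h
    exact Real.log_lt_log (hpos i) (by nlinarith)
  · intro b t y z l h1 h2 h3
    rw [← Real.log_mul (hpos _).ne' (hpos _).ne', ← Real.log_mul (hpos _).ne' (hpos _).ne',
      ← Real.log_mul (mul_pos (hpos _) (hpos _)).ne' (hpos _).ne']
    refine Real.log_lt_log (mul_pos (hpos _) (hpos _)) ?_
    have h1' : (b : ℝ) < l := by exact_mod_cast h1
    have h2' : (b : ℝ) < y + z := by exact_mod_cast h2
    have h3' : (b : ℝ) + t ≤ y + z + l := by exact_mod_cast h3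
    have hB := hpos b
    have hL := hpos l
    have hyz : a + ((y : ℝ) + z) * d ≤ (a + y * d) * (a + z * d) := by
      have e1 : 0 ≤ (y : ℝ) * d := by positivity
      have e2 : 0 ≤ (z : ℝ) * d := by positivity
      nlinarith [mul_nonneg e1 e2, mul_nonneg (sub_nonneg.2 ha) e1,
        mul_nonneg (sub_nonneg.2 ha) e2]
    have k1 : 0 < (a + ((y : ℝ) + z) * d) - (a + b * d) := by nlinarith
    have k2 : 0 < (a + (l : ℝ) * d) - (a + b * d) := by nlinarith
    have k3 : a + (t : ℝ) * d ≤ (a + ((y : ℝ) + z) * d) + (a + l * d) - (a + b * d) := by nlinarith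
    calc (a + (b : ℝ) * d) * (a + t * d)
        ≤ (a + (b : ℝ) * d) * ((a + ((y : ℝ) + z) * d) + (a + l * d) - (a + b * d)) :=
          mul_le_mul_of_nonneg_left k3 hB.le
      _ < (a + ((y : ℝ) + z) * d) * (a + l * d) := by linarith [mul_pos k1 k2]
      _ ≤ _ := mul_le_mul_of_nonneg_right hyz hL.le
  · intro b t y z h1 h2 h3
    rw [← Real.log_mul (hpos _).ne' (hpos _).ne', ← Real.log_mul (hpos _).ne' (hpos _).ne']
    refine Real.log_lt_log (mul_pos (hpos _) (hpos _)) ?_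
    have h1' : (b : ℝ) < y := by exact_mod_cast h1
    have h2' : (b : ℝ) < z := by exact_mod_cast h2
    have h3' : (b : ℝ) + t < y + z := by exact_mod_cast h3
    have hB := hpos b
    have k1 : 0 < (a + (y : ℝ) * d) - (a + b * d) := by nlinarith
    have k2 : 0 < (a + (z : ℝ) * d) - (a + b * d) := by nlinarith
    have k3 : a + (t : ℝ) * d ≤ (a + (y : ℝ) * d) + (a + z * d) - (a + b * d) := by nlinarith
    calc (a + (b : ℝ) * d) * (a + t * d)
        ≤ (a + (b : ℝ) * d) * ((a + (y : ℝ) * d) + (a + z * d) - (a + b * d)) :=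
          mul_le_mul_of_nonneg_left k3 hB.le
      _ < (a + (y : ℝ) * d) * (a + z * d) := by linarith [mul_pos k1 k2]
  · intro y l h1 h2
    rw [← Real.log_mul (hpos _).ne' (hpos _).ne']
    refine Real.log_lt_log (hpos _) ?_
    have e1 : 0 < (y : ℝ) * d := by
      have : (0 : ℝ) < y := by exact_mod_cast h1
      positivity
    have e2 : 0 < (l : ℝ) * d := by
      have : (0 : ℝ) < l := by exact_mod_cast h2
      positivity
    push_cast
    nlinarith [mul_pos e1 e2, mul_nonneg (sub_nonneg.2 ha) e1.le,
        mul_nonneg (sub_nonneg.2 ha) e2.le]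

/-- The position of `v` in `H` sorted by `s`, ties being broken by the natural order. -/
noncomputable def sortRank (H : Finset ℕ) (s : ℕ → ℝ) (v : ℕ) : ℕ :=
  (H.filter fun u => s u < s v ∨ s u = s v ∧ u < v).card

theorem sortRank_lt_card {H : Finset ℕ} {s : ℕ → ℝ} {v : ℕ} (hv : v ∈ H) :
    sortRank H s v < H.card := by
  apply Finset.card_lt_card
  refine Finset.filter_ssubset.2 ⟨v, hv, by simp⟩

theorem sortRank_lt_sortRank {H : Finset ℕ} {s : ℕ → ℝ} {u v : ℕ} (hu : u ∈ H)
    (h : s u < s v ∨ s u = s v ∧ u < v) : sortRank H s u < sortRank H s v := by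
  apply Finset.card_lt_card
  refine Finset.ssubset_iff_of_subset ?_ |>.2 ⟨u, by simp [hu, h], by simp⟩
  intro w hw
  simp only [Finset.mem_filter] at hw ⊢
  refine ⟨hw.1, ?_⟩
  rcases hw.2 with h1 | h1 <;> rcases h with h2 | h2
  · exact Or.inl (h1.trans h2)
  · exact Or.inl (h2.1 ▸ h1)
  · exact Or.inl (h1.1 ▸ h2)
  · exact Or.inr ⟨h1.1.trans h2.1, h1.2.trans h2.2⟩

theorem injOn_sortRank (H : Finset ℕ) (s : ℕ → ℝ) : Set.InjOn (sortRank H s) H := by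
  intro u hu v hv h
  by_contra hne
  rcases lt_trichotomy (s u) (s v) with h1 | h1 | h1
  · exact (sortRank_lt_sortRank hu (Or.inl h1)).ne h
  · rcases lt_or_gt_of_ne hne with h2 | h2
    · exact (sortRank_lt_sortRank hu (Or.inr ⟨h1, h2⟩)).ne h
    · exact (sortRank_lt_sortRank hv (Or.inr ⟨h1.symm, h2⟩)).ne h.symm
  · exact (sortRank_lt_sortRank hv (Or.inl h1)).ne h.symm

theorem injOn_add_sortRank {g : ℕ → ℝ} (hg : StrictMono g) (H : Finset ℕ) (s : ℕ → ℝ) (b : ℕ) :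
    Set.InjOn (fun v => s v + g (b + sortRank H s v)) H := by
  have key : ∀ u ∈ H, ∀ v ∈ H, (s u < s v ∨ s u = s v ∧ u < v) →
      s u + g (b + sortRank H s u) < s v + g (b + sortRank H s v) := by
    intro u hu v _ h
    have h1 := hg (Nat.add_lt_add_left (sortRank_lt_sortRank hu h) b)
    have h2 : s u ≤ s v := by
      rcases h with h | h
      · exact h.le
      · exact h.1.le
    linarith
  intro u hu v hv h
  by_contra hne
  rcases lt_trichotomy (s u) (s v) with h1 | h1 | h1
  · exact (key u hu v hv (Or.inl h1)).ne h
  · rcases lt_or_gt_of_ne hne with h2 | h2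
    · exact (key u hu v hv (Or.inr ⟨h1, h2⟩)).ne h
    · exact (key v hv u hu (Or.inr ⟨h1.symm, h2⟩)).ne h.symm
  · exact (key v hv u hu (Or.inl h1)).ne h.symm

/-- Lowering all of `O` and raising `0` can only increase the number of elements of `O` whose
sorted value is below a threshold. -/
theorem card_sorted_le_mono {g : ℕ → ℝ} (hg : StrictMono g) {O : Finset ℕ} (h0 : 0 ∉ O)
    {s s' : ℕ → ℝ} (b : ℕ) (hO : ∀ o ∈ O, s' o ≤ s o) (hz : s 0 ≤ s' 0) (P : ℝ) :
    (O.filter fun o => s o + g (b + sortRank (insert 0 O) s o) ≤ P).card ≤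
      (O.filter fun o => s' o + g (b + sortRank (insert 0 O) s' o) ≤ P).card := by
  set D := O.filter fun o => s o + g (b + sortRank (insert 0 O) s o) ≤ P with hD
  set E := O.filter fun o => s' o + g (b + sortRank (insert 0 O) s' o) ≤ P with hE
  by_contra! hlt
  have hDne : D.Nonempty := Finset.card_pos.1 (by omega)
  obtain ⟨d, hd, hdmax⟩ := D.exists_max_image (sortRank (insert 0 O) s) hDne
  have hdO : d ∈ O := (Finset.mem_filter.1 hd).1
  have hdP := (Finset.mem_filter.1 hd).2
  have hcmp : ∀ u ∈ insert 0 O, sortRank (insert 0 O) s u ≤ sortRank (insert 0 O) s d →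
      u = d ∨ (s u < s d ∨ s u = s d ∧ u < d) := by
    intro u hu hle
    by_contra! hcon
    have : s d < s u ∨ s d = s u ∧ d < u := by
      rcases lt_or_eq_of_le hcon.2.1 with h | h
      · exact Or.inl h
      · exact Or.inr ⟨h, lt_of_le_of_ne (hcon.2.2 h.symm) (Ne.symm hcon.1)⟩
    exact absurd (sortRank_lt_sortRank (Finset.mem_insert_of_mem hdO) this) (not_lt.2 hle)
  have hDd : ∀ u ∈ D, u = d ∨ (s u < s d ∨ s u = s d ∧ u < d) := fun u hu =>
    hcmp u (Finset.mem_insert_of_mem (Finset.mem_filter.1 hu).1) (hdmax u hu)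
  have hDs : ∀ u ∈ D, s' u ≤ s d := by
    intro u hu
    have h1 := hO u (Finset.mem_filter.1 hu).1
    rcases hDd u hu with h | h | h
    · rw [← h]; exact h1
    · linarith
    · linarith [h.1]
  set B := O.filter fun o => s' o ≤ s d ∧ ¬ (s' o + g (b + sortRank (insert 0 O) s' o) ≤ P)
    with hB
  have hBne : B.Nonempty := by
    by_contra hBe
    rw [Finset.not_nonempty_iff_eq_empty] at hBe
    refine absurd (Finset.card_le_card (s := D) (t := E) fun u hu => ?_) (not_le.2 hlt)
    by_contra hu'
    have : u ∈ B := by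
      have hu1 := (Finset.mem_filter.1 hu).1
      rw [hB, Finset.mem_filter]
      refine ⟨hu1, hDs u hu, fun h => hu' ?_⟩
      rw [hE, Finset.mem_filter]
      exact ⟨hu1, h⟩
    simp [hBe] at this
  obtain ⟨o, ho, homin⟩ := B.exists_min_image (sortRank (insert 0 O) s') hBne
  obtain ⟨hoO, hos, hoP⟩ := Finset.mem_filter.1 ho
  have hrank : sortRank (insert 0 O) s' o ≤ sortRank (insert 0 O) s d := by
    have hdpos : d ≠ 0 := fun h => h0 (h ▸ hdO)
    have hsub : ∀ u ∈ O, (s' u < s' o ∨ s' u = s' o ∧ u < o) → u ∈ E := by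
      intro u hu h
      by_contra hu'
      have : u ∈ B := by
        rw [hB, Finset.mem_filter]
        refine ⟨hu, ?_, fun h => hu' ?_⟩
        · rcases h with h | h
          · linarith
          · linarith [h.1]
        · rw [hE, Finset.mem_filter]
          exact ⟨hu, h⟩
      exact absurd (sortRank_lt_sortRank (Finset.mem_insert_of_mem hu) h)
        (not_lt.2 (homin u this))
    unfold sortRank
    rw [Finset.filter_insert, Finset.filter_insert]
    have e1 : (O.filter fun u => s' u < s' o ∨ s' u = s' o ∧ u < o).card ≤ E.card :=
      Finset.card_le_card fun u hu => hsub u (Finset.mem_filter.1 hu).1 (Finset.mem_filter.1 hu).2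
    have e2 : D.card ≤ (O.filter fun u => s u < s d ∨ s u = s d ∧ u < d).card + 1 := by
      rw [← Finset.card_erase_add_one hd]
      gcongr
      intro u hu
      have hu' := Finset.mem_erase.1 hu
      exact Finset.mem_filter.2 ⟨(Finset.mem_filter.1 hu'.2).1, (hDd u hu'.2).resolve_left hu'.1⟩
    split_ifs with c1 c2 c2
    · rw [Finset.card_insert_of_notMem (by simp [h0]), Finset.card_insert_of_notMem (by simp [h0])]
      omega
    · exfalso
      apply c2
      have h1 : s' 0 ≤ s' o := by
        rcases c1 with h | h
        · exact h.le
        · exact h.1.le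
      rcases lt_or_eq_of_le (hz.trans (h1.trans hos)) with h | h
      · exact Or.inl h
      · exact Or.inr ⟨h, Nat.pos_of_ne_zero hdpos⟩
    · rw [Finset.card_insert_of_notMem (by simp [h0])]
      omega
    · omega
  apply hoP
  have := hg.monotone (Nat.add_le_add_left hrank b)
  linarith

theorem exists_no_collision {g : ℕ → ℝ} (hg : StrictMono g) {O Q : Finset ℕ} (h0 : 0 ∉ O)
    (hcard : O.card < Q.card) (s : ℕ → ℕ → ℝ) (p : ℕ → ℝ) (b : ℕ)
    (hp : ∀ q ∈ Q, ∀ q' ∈ Q, q < q' → p q < p q')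
    (hO : ∀ q ∈ Q, ∀ q' ∈ Q, q < q' → ∀ o ∈ O, s q' o ≤ s q o)
    (hz : ∀ q ∈ Q, ∀ q' ∈ Q, q < q' → s q 0 ≤ s q' 0) :
    ∃ q ∈ Q, ∀ o ∈ O, s q o + g (b + sortRank (insert 0 O) (s q) o) ≠ p q := by
  by_contra! hcon
  set K : ℕ → ℕ := fun q =>
    (O.filter fun o => s q o + g (b + sortRank (insert 0 O) (s q) o) < p q).card with hK
  have hlt : ∀ q ∈ Q, K q <
      (O.filter fun o => s q o + g (b + sortRank (insert 0 O) (s q) o) ≤ p q).card := by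
    intro q hq
    obtain ⟨o, ho, heq⟩ := hcon q hq
    apply Finset.card_lt_card
    refine (Finset.ssubset_iff_of_subset ?_).2 ⟨o, by simp [ho, heq], by simp [heq]⟩
    intro u hu
    rw [Finset.mem_filter] at hu ⊢
    exact ⟨hu.1, hu.2.le⟩
  have hmono : ∀ q ∈ Q, ∀ q' ∈ Q, q < q' → K q < K q' := by
    intro q hq q' hq' h
    refine (hlt q hq).trans_le ((card_sorted_le_mono hg h0 b (hO q hq q' hq' h)
      (hz q hq q' hq' h) (p q)).trans (Finset.card_le_card fun u hu => ?_))
    rw [Finset.mem_filter] at hu ⊢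
    exact ⟨hu.1, hu.2.trans_lt (hp q hq q' hq' h)⟩
  have hmaps : Set.MapsTo K Q (Finset.range O.card) := by
    intro q hq
    simp only [Finset.coe_range, Set.mem_Iio]
    exact (hlt q hq).trans_le (Finset.card_filter_le _ _)
  obtain ⟨q, hq, q', hq', hne, heq⟩ :=
    Finset.exists_ne_map_eq_of_card_lt_of_maps_to (by simpa using hcard) hmaps
  rcases lt_or_gt_of_ne hne with h | h
  · exact (hmono q hq q' hq' h).ne heq
  · exact (hmono q' hq' q hq h).ne heq.symm

/-- The predecessor of `j` on the cycle with vertices `0, …, n - 1`. -/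
def cyclePred (n j : ℕ) : ℕ := if j = 0 then n - 1 else j - 1

/-- A labeling of the leafy cycle with cycle vertices `0, …, n - 1`, leaf set `X`, leaf `x` being
attached to `own x`: the label indices are `c i` on the cycle edge leaving vertex `i` and `L x` on
the pendant edge at `x`. -/
def HasLeafyLabeling (g : ℕ → ℝ) (n : ℕ) {X : Type*} [Fintype X] (own : X → ℕ) : Prop :=
  ∃ (c : ℕ → ℕ) (L : X → ℕ),
    Set.InjOn c (Set.Iio n) ∧ Function.Injective L ∧ (∀ i < n, ∀ x, c i ≠ L x) ∧
    (∀ i < n, c i < n + Fintype.card X) ∧ (∀ x, L x < n + Fintype.card X) ∧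
    Set.InjOn (fun j => g (c j) + g (c (cyclePred n j)) +
      ∑ x ∈ Finset.univ.filter (fun x => own x = j), g (L x)) (Set.Iio n) ∧
    ∀ j < n, ∀ x, g (c j) + g (c (cyclePred n j)) +
      ∑ x ∈ Finset.univ.filter (fun x => own x = j), g (L x) ≠ g (L x)

theorem cyclePred_lt {n j : ℕ} (h : j < n) : cyclePred n j < n := by
  unfold cyclePred; split_ifs <;> omega

theorem exists_extra_leaves {g : ℕ → ℝ} (hg : Admissible g) {n : ℕ} {X : Type*} [Fintype X]
    (own : X → ℕ) (H : Finset ℕ) (hH : H = Finset.univ.image own) :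
    H.card ≤ Fintype.card X ∧ ∃ ext : ℕ → ℝ, (∀ v, 0 ≤ ext v) ∧
      ∀ (x M : ℕ) (c lam : ℕ → ℕ), x + H.card = Fintype.card X → Set.InjOn c (Set.Iio n) →
      (∀ i < n, (x ≤ c i ∧ c i < x + M) ∨
        (x + M + H.card ≤ c i ∧ c i < n + Fintype.card X)) → M ≤ n →
      Set.InjOn lam H → (∀ h ∈ H, x + M ≤ lam h ∧ lam h < x + M + H.card) →
      (∀ i < n, x + M + H.card ≤ c i ∨ x + M + H.card ≤ c (cyclePred n i)) →
      Set.InjOn (fun j => g (c j) + g (c (cyclePred n j)) +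
        if j ∈ H then ext j + g (lam j) else 0) (Set.Iio n) →
      HasLeafyLabeling g n own := by
  have hex : ∀ h : ℕ, h ∈ H → ∃ x, own x = h := by
    intro h hh
    simpa [hH] using hh
  have hown : ∀ x, own x ∈ H := fun x => by simp [hH]
  choose priv hpriv using fun (h : H) => hex h.1 h.2
  let pr : X → X := fun x => priv ⟨own x, hown x⟩
  have hpr : ∀ x, own (pr x) = own x := fun x => hpriv ⟨own x, hown x⟩
  have hpr2 : ∀ x y, own x = own y → pr x = pr y := by
    intro x y h
    simp only [pr, h]
  set S := Finset.univ.filter fun x => x ≠ pr x with hS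
  set R := Finset.univ.filter fun x => x = pr x with hR
  have hRH : R.card = H.card := by
    refine Finset.card_bij (fun x _ => own x) (fun x _ => hown x) ?_ ?_
    · intro x hx y hy h
      rw [(Finset.mem_filter.1 hx).2, (Finset.mem_filter.1 hy).2]
      exact hpr2 x y h
    · intro h hh
      refine ⟨priv ⟨h, hh⟩, ?_, hpriv ⟨h, hh⟩⟩
      rw [hR, Finset.mem_filter]
      refine ⟨Finset.mem_univ _, ?_⟩
      simp only [pr, hpriv ⟨h, hh⟩]
  have hRS : R.card + S.card = Fintype.card X :=
    Finset.card_filter_add_card_filter_not _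
  let ex : X → ℕ := fun x => if h : x ∈ S then (S.equivFin ⟨x, h⟩ : ℕ) else 0
  have hex_lt : ∀ x ∈ S, ex x < S.card := by
    intro x hx
    simp only [ex, hx, dif_pos]
    exact (S.equivFin ⟨x, hx⟩).2
  have hex_inj : ∀ x ∈ S, ∀ y ∈ S, ex x = ex y → x = y := by
    intro x hx y hy h
    simp only [ex, hx, hy, dif_pos] at h
    simpa using S.equivFin.injective (Fin.ext h)
  refine ⟨by omega, fun v => ∑ x ∈ S.filter (fun x => own x = v), g (ex x),
    fun v => Finset.sum_nonneg fun _ _ => hg.nonneg _, ?_⟩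
  intro x0 M c lam hx0 hc hcr hM hlam hlamr ht hw
  have hSx : S.card = x0 := by omega
  let L : X → ℕ := fun x => if x ∈ S then ex x else lam (own x)
  have hLS : ∀ x ∈ S, L x = ex x := fun x hx => if_pos hx
  have hLR : ∀ x ∉ S, L x = lam (own x) := fun x hx => if_neg hx
  have hSR : ∀ x, x ∉ S → x = pr x := fun x hx => by
    by_contra h
    exact hx (by simp [hS, h])
  have hLlt : ∀ x, L x < x0 + M + H.card := by
    intro x
    by_cases hx : x ∈ S
    · rw [hLS x hx]; have := hex_lt x hx; omega
    · rw [hLR x hx]; exact (hlamr _ (hown x)).2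
  have hLcase : ∀ x, L x < x0 ∨ x0 + M ≤ L x := by
    intro x
    by_cases hx : x ∈ S
    · rw [hLS x hx]; have := hex_lt x hx; omega
    · rw [hLR x hx]; exact Or.inr (hlamr _ (hown x)).1
  have hsum : ∀ j, ∑ x ∈ Finset.univ.filter (fun x => own x = j), g (L x) =
      if j ∈ H then (∑ x ∈ S.filter (fun x => own x = j), g (ex x)) + g (lam j) else 0 := by
    intro j
    split_ifs with hj
    · rw [← Finset.sum_filter_add_sum_filter_not (Finset.univ.filter fun x => own x = j)
        (fun x => x ∈ S)]
      congr 1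
      · refine Finset.sum_congr ?_ ?_
        · ext x; simp [and_comm]
        · intro x hx
          rw [hLS x (Finset.mem_filter.1 hx).1]
      · have : (Finset.univ.filter fun x => own x = j).filter (fun x => x ∉ S) =
            {priv ⟨j, hj⟩} := by
          ext x
          simp only [Finset.mem_filter, Finset.mem_univ, true_and, Finset.mem_singleton]
          constructor
          · rintro ⟨h1, h2⟩
            rw [hSR x h2]
            simp only [pr, h1]
          · rintro rfl
            refine ⟨hpriv ⟨j, hj⟩, ?_⟩
            simp [hS, pr, hpriv ⟨j, hj⟩]
        rw [this, Finset.sum_singleton, hLR, hpriv ⟨j, hj⟩]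
        simp [hS, pr, hpriv ⟨j, hj⟩]
    · rw [Finset.sum_eq_zero]
      intro x hx
      exact absurd ((Finset.mem_filter.1 hx).2 ▸ hown x) hj
  refine ⟨c, L, hc, ?_, ?_, ?_, ?_, ?_, ?_⟩
  · intro x y h
    by_cases hx : x ∈ S <;> by_cases hy : y ∈ S
    · rw [hLS x hx, hLS y hy] at h
      exact hex_inj x hx y hy h
    · have h1 := hex_lt x hx
      have h2 := (hlamr _ (hown y)).1
      rw [hLS x hx, hLR y hy] at h
      omega
    · have h1 := hex_lt y hy
      have h2 := (hlamr _ (hown x)).1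
      rw [hLS y hy, hLR x hx] at h
      omega
    · rw [hLR x hx, hLR y hy] at h
      rw [hSR x hx, hSR y hy]
      exact hpr2 x y (hlam (hown x) (hown y) h)
  · intro i hi x h
    have h1 := hLlt x
    have h2 := hLcase x
    have h3 := hcr i hi
    omega
  · intro i hi
    have h3 := hcr i hi
    omega
  · intro x
    have := hLlt x
    omega
  · simp only [hsum]
    exact hw
  · intro j hj x
    rw [hsum]
    apply ne_of_gt
    have h1 : g (L x) < g (c j) + g (c (cyclePred n j)) := by
      rcases ht j hj with h | h
      · have := hg.mono ((hLlt x).trans_le h)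
        have := hg.nonneg (c (cyclePred n j))
        linarith
      · have := hg.mono ((hLlt x).trans_le h)
        have := hg.nonneg (c j)
        linarith
    have h2 : (0 : ℝ) ≤ if j ∈ H then
        (∑ x ∈ S.filter (fun x => own x = j), g (ex x)) + g (lam j) else 0 := by
      split_ifs
      · exact add_nonneg (Finset.sum_nonneg fun _ _ => hg.nonneg _) (hg.nonneg _)
      · exact le_rfl
    linarith

/-- The sign walk around a cycle: a mode switches exactly at the flagged vertices, and from a
suitable flagged starting vertex the mode `true` is always in the majority. -/
theorem exists_majority_start (N : ℕ) (hN : 0 < N) (F : ℕ → Prop) (h0 : F 0)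
    (hF : ∀ k, F (k + N) ↔ F k) :
    ∃ m < N, F m ∧ ∃ md : ℕ → Bool, md 0 = true ∧ (∀ j, F (m + (j + 1)) ↔ md (j + 1) ≠ md j) ∧
      ∀ i, i ≤ 2 * ((Finset.range i).filter fun j => md j = true).card := by
  let b₀ : ℕ → Bool := fun k =>
    Nat.rec true (fun j v => if F (j + 1) then !v else v) k
  have hb₀ : ∀ k, F (k + 1) ↔ b₀ (k + 1) ≠ b₀ k := by
    intro k
    have : b₀ (k + 1) = if F (k + 1) then !(b₀ k) else b₀ k := rfl
    rw [this]
    split_ifs with h <;> simp [h]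
  let A : (ℕ → Bool) → ℕ → ℤ := fun b k => ∑ j ∈ Finset.range k, if b j then 1 else -1
  have hper : ∀ b : ℕ → Bool, (∀ k, F (k + 1) ↔ b (k + 1) ≠ b k) →
      ∀ k, b (k + 2 * N) = b k := by
    intro b hb
    have h1 : ∀ k, (b (k + N) ^^ b k) = (b N ^^ b 0) := by
      intro k
      induction k with
      | zero => simp
      | succ k ih =>
        rw [← ih]
        have e1 := hb (k + N)
        have e2 := hb k
        have e3 := hF (k + 1)
        rw [show k + 1 + N = k + N + 1 by ring] at *
        have e4 : (b (k + N + 1) ≠ b (k + N)) ↔ (b (k + 1) ≠ b k) := by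
          rw [← e1, ← e2, e3]
        revert e4
        cases b (k + N + 1) <;> cases b (k + N) <;> cases b (k + 1) <;> cases b k <;> simp
    intro k
    have e1 := h1 k
    have e2 := h1 (k + N)
    rw [← e1, show k + N + N = k + 2 * N by ring] at e2
    revert e2
    cases b (k + 2 * N) <;> cases b (k + N) <;> cases b k <;> simp
  obtain ⟨b, hb, hA⟩ : ∃ b : ℕ → Bool, (∀ k, F (k + 1) ↔ b (k + 1) ≠ b k) ∧
      0 ≤ A b (2 * N) := by
    by_cases h : 0 ≤ A b₀ (2 * N)
    · exact ⟨b₀, hb₀, h⟩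
    · refine ⟨fun k => !(b₀ k), fun k => ?_, ?_⟩
      · rw [hb₀ k]; simp
      · have : A (fun k => !(b₀ k)) (2 * N) = - A b₀ (2 * N) := by
          simp only [A, ← Finset.sum_neg_distrib]
          refine Finset.sum_congr rfl fun j _ => ?_
          by_cases hh : b₀ j = true <;> simp [hh]
        omega
  have hAper : ∀ k, A b (k + 2 * N) = A b k + A b (2 * N) := by
    intro k
    induction k with
    | zero => simp [A]
    | succ k ih =>
      rw [show k + 1 + 2 * N = (k + 2 * N) + 1 by ring]
      have e1 : ∀ j, A b (j + 1) = A b j + if b j then 1 else -1 := fun j => by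
        simp only [A, Finset.sum_range_succ]
      rw [e1, e1, ih, hper b hb]
      ring
  have hstep : ∀ j, A b (j + 1) = A b j + if b j then 1 else -1 := fun j => by
    simp only [A, Finset.sum_range_succ]
  obtain ⟨m, hm, hmin⟩ := (Finset.range (2 * N)).exists_min_image (A b)
    ⟨0, Finset.mem_range.2 (by omega)⟩
  have hmin' : ∀ k, A b m ≤ A b k := by
    intro k
    induction k using Nat.strong_induction_on with
    | _ k ih =>
      by_cases hk : k < 2 * N
      · exact hmin k (Finset.mem_range.2 hk)
      · obtain ⟨k', rfl⟩ : ∃ k', k = k' + 2 * N := ⟨k - 2 * N, by omega⟩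
        have := ih k' (by omega)
        rw [hAper]
        omega
  have hbm : b m = true := by
    have h1 := hmin' (m + 1)
    rw [hstep] at h1
    by_contra h
    simp [h] at h1
  have hFm : F m := by
    rcases Nat.eq_zero_or_pos m with h | h
    · rw [h]; exact h0
    · obtain ⟨k, rfl⟩ : ∃ k, m = k + 1 := ⟨m - 1, by omega⟩
      rw [hb k, hbm]
      intro h'
      have h1 := hmin' k
      rw [hstep] at h1
      simp [← h'] at h1
  have hcount : ∀ i, A b (m + i) = A b m +
      (2 * ((Finset.range i).filter fun j => b (m + j) = true).card - i) := by
    intro i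
    induction i with
    | zero => simp
    | succ i ih =>
      rw [← add_assoc, hstep, ih, Finset.range_add_one, Finset.filter_insert]
      split_ifs with h
      · rw [Finset.card_insert_of_notMem (by simp)]
        push_cast
        ring
      · push_cast
        ring
  have hmd : ∀ i, i ≤ 2 * ((Finset.range i).filter fun j => b (m + j) = true).card := by
    intro i
    have h1 := hmin' (m + i)
    have h2 := hcount i
    omega
  have hflip : ∀ j, F (m + (j + 1)) ↔ b (m + (j + 1)) ≠ b (m + j) := fun j => hb (m + j)
  by_cases hmN : m < N
  · exact ⟨m, hmN, hFm, fun j => b (m + j), hbm, hflip, hmd⟩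
  · obtain ⟨k, rfl⟩ : ∃ k, m = k + N := ⟨m - N, by omega⟩
    rw [Finset.mem_range] at hm
    refine ⟨k, by omega, (hF k).1 hFm, fun j => b (k + N + j), hbm, fun j => ?_, hmd⟩
    rw [← hflip, ← hF]
    rw [show k + (j + 1) + N = k + N + (j + 1) by ring]

/-- The number of positions `j < i` of the parity of `i` in the given mode. -/
def modeCount (md : ℕ → Bool) (v : Bool) (i : ℕ) : ℕ :=
  ((Finset.range i).filter fun j => j % 2 = i % 2 ∧ md j = v).card

/-- The labels of a path with edges `0, …, N - 1`: even edges get the top labels, odd edges the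
bottom ones; edges in mode `true` are labeled from below, the others from above. -/
def pathLabel (N : ℕ) (md : ℕ → Bool) (i : ℕ) : ℕ :=
  if md i then (if i % 2 = 0 then N / 2 else 0) + modeCount md true i
  else (if i % 2 = 0 then N - 1 else N / 2 - 1) - modeCount md false i

theorem modeCount_add (md : ℕ → Bool) (i : ℕ) :
    modeCount md true i + modeCount md false i = i / 2 := by
  have h : modeCount md true i + modeCount md false i =
      ((Finset.range i).filter fun j => j % 2 = i % 2).card := by
    rw [← Finset.card_filter_add_card_filter_not (s := (Finset.range i).filter
      fun j => j % 2 = i % 2) (fun j => md j = true)]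
    simp only [modeCount, Finset.filter_filter, Bool.not_eq_true]
  rw [h, ← Nat.count_eq_card_filter_range]
  have := Nat.count_modEq_card (r := 2) i (by norm_num) (i % 2)
  simp only [Nat.ModEq, Nat.mod_mod] at this
  rw [this]
  split_ifs with h2 <;> omega

theorem modeCount_lt (md : ℕ → Bool) {i k : ℕ} (h : i < k) (hp : i % 2 = k % 2) :
    modeCount md (md i) i < modeCount md (md i) k := by
  refine Finset.card_lt_card ((Finset.ssubset_iff_of_subset fun j hj => ?_).2 ⟨i, ?_, by simp⟩)
  · simp only [Finset.mem_filter, Finset.mem_range] at hj ⊢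
    exact ⟨by omega, by omega, hj.2.2⟩
  · simp [h, hp]

theorem modeCount_add_modeCount_pred (md : ℕ → Bool) (v : Bool) (i : ℕ) :
    modeCount md v (i + 1) + modeCount md v i =
      ((Finset.range i).filter fun j => md j = v).card := by
  rw [← Finset.card_filter_add_card_filter_not (s := (Finset.range i).filter
      fun j => md j = v) (fun j => j % 2 = (i + 1) % 2)]
  congr 1
  · unfold modeCount
    congr 1
    ext j
    simp only [Finset.mem_filter, Finset.mem_range]
    constructor
    · rintro ⟨h1, h2, h3⟩
      exact ⟨⟨by omega, h3⟩, h2⟩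
    · rintro ⟨⟨h1, h3⟩, h2⟩
      exact ⟨by omega, h2, h3⟩
  · unfold modeCount
    congr 1
    ext j
    simp only [Finset.mem_filter, Finset.mem_range]
    constructor
    · rintro ⟨h1, h2, h3⟩
      exact ⟨⟨by omega, h3⟩, by omega⟩
    · rintro ⟨⟨h1, h3⟩, h2⟩
      exact ⟨by omega, by omega, h3⟩

theorem pathLabel_true {N : ℕ} {md : ℕ → Bool} {i : ℕ} (h : md i = true) :
    pathLabel N md i = (if i % 2 = 0 then N / 2 else 0) + modeCount md true i := by
  simp [pathLabel, h]

theorem pathLabel_false {N : ℕ} {md : ℕ → Bool} {i : ℕ} (h : md i = false) :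
    pathLabel N md i = (if i % 2 = 0 then N - 1 else N / 2 - 1) - modeCount md false i := by
  simp [pathLabel, h]

theorem pathLabel_lt {N : ℕ} (md : ℕ → Bool) {i : ℕ} (hi : i < N) : pathLabel N md i < N := by
  have h := modeCount_add md i
  cases hm : md i
  · rw [pathLabel_false hm]; split_ifs <;> omega
  · rw [pathLabel_true hm]; split_ifs <;> omega

theorem pathLabel_even {N : ℕ} (md : ℕ → Bool) {i : ℕ} (hi : i < N) (he : i % 2 = 0) :
    N / 2 ≤ pathLabel N md i := by
  have h := modeCount_add md i
  cases hm : md i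
  · rw [pathLabel_false hm, if_pos he]; omega
  · rw [pathLabel_true hm, if_pos he]; omega

theorem pathLabel_odd {N : ℕ} (md : ℕ → Bool) {i : ℕ} (hi : i < N) (he : i % 2 = 1) :
    pathLabel N md i < N / 2 := by
  have h := modeCount_add md i
  cases hm : md i
  · rw [pathLabel_false hm, if_neg (by omega)]; omega
  · rw [pathLabel_true hm, if_neg (by omega)]; omega

theorem pathLabel_lt_of_true {N : ℕ} {md : ℕ → Bool} {i k : ℕ} (hik : i < k) (hk : k < N)
    (hp : i % 2 = k % 2) (hm : md i = true) : pathLabel N md i < pathLabel N md k := by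
  have h1 := modeCount_lt md hik hp
  rw [hm] at h1
  have h2 := modeCount_add md k
  rw [pathLabel_true hm]
  cases hk' : md k
  · rw [pathLabel_false hk', hp]; split_ifs <;> omega
  · rw [pathLabel_true hk', hp]; omega

theorem pathLabel_lt_of_false {N : ℕ} {md : ℕ → Bool} {i k : ℕ} (hik : i < k) (hk : k < N)
    (hp : i % 2 = k % 2) (hm : md i = false) : pathLabel N md k < pathLabel N md i := by
  have h1 := modeCount_lt md hik hp
  rw [hm] at h1
  have h2 := modeCount_add md k
  rw [pathLabel_false hm]
  cases hk' : md k
  · rw [pathLabel_false hk', hp]; split_ifs <;> omega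
  · rw [pathLabel_true hk', hp]; split_ifs <;> omega

theorem injOn_pathLabel (N : ℕ) (md : ℕ → Bool) : Set.InjOn (pathLabel N md) (Set.Iio N) := by
  have key : ∀ i k, i < k → k < N → pathLabel N md i ≠ pathLabel N md k := by
    intro i k hik hk
    by_cases hp : i % 2 = k % 2
    · cases hm : md i
      · exact (pathLabel_lt_of_false hik hk hp hm).ne'
      · exact (pathLabel_lt_of_true hik hk hp hm).ne
    · rcases Nat.mod_two_eq_zero_or_one i with h | h
      · have h1 := pathLabel_even md (hik.trans hk) h
        have h2 := pathLabel_odd md hk (by omega)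
        omega
      · have h1 := pathLabel_odd md (hik.trans hk) h
        have h2 := pathLabel_even md hk (by omega)
        omega
  intro i hi k hk h
  by_contra hne
  rcases lt_or_gt_of_ne hne with h' | h'
  · exact key i k h' hk h
  · exact key k i h' hi h.symm

/-- Vertices at which the mode does not switch have distinct sums. -/
theorem pathLabel_sum_ne {N : ℕ} {md : ℕ → Bool} {G : ℕ → ℝ} (hG : StrictMono G) {i k : ℕ}
    (hik : i < k) (hk : k + 1 < N) (hm : md (i + 1) = md i) :
    G (pathLabel N md (i + 1)) + G (pathLabel N md i) ≠
      G (pathLabel N md (k + 1)) + G (pathLabel N md k) := by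
  cases hi : md i
  · have hi' := hm.trans hi
    apply ne_of_gt
    by_cases hp : i % 2 = k % 2
    · have h1 := hG (pathLabel_lt_of_false (N := N) hik (by omega) hp hi)
      have h2 := hG (pathLabel_lt_of_false (N := N) (show i + 1 < k + 1 by omega) hk (by omega) hi')
      linarith
    · have h1 := hG (pathLabel_lt_of_false (N := N) (show i < k + 1 by omega) hk (by omega) hi)
      rcases eq_or_lt_of_le (show i + 1 ≤ k by omega) with h | h
      · rw [← h] at h1 ⊢
        linarith
      · have h2 := hG (pathLabel_lt_of_false (N := N) h (by omega) (by omega) hi')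
        linarith
  · have hi' := hm.trans hi
    apply ne_of_lt
    by_cases hp : i % 2 = k % 2
    · have h1 := hG (pathLabel_lt_of_true (N := N) hik (by omega) hp hi)
      have h2 := hG (pathLabel_lt_of_true (N := N) (show i + 1 < k + 1 by omega) hk (by omega) hi')
      linarith
    · have h1 := hG (pathLabel_lt_of_true (N := N) (show i < k + 1 by omega) hk (by omega) hi)
      rcases eq_or_lt_of_le (show i + 1 ≤ k by omega) with h | h
      · rw [← h] at h1 ⊢
        linarith
      · have h2 := hG (pathLabel_lt_of_true (N := N) h (by omega) (by omega) hi')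
        linarith

theorem card_filter_range_succ (md : ℕ → Bool) (i : ℕ) :
    ((Finset.range (i + 1)).filter fun j => md j = true).card =
      ((Finset.range i).filter fun j => md j = true).card + if md i = true then 1 else 0 := by
  rw [Finset.range_add_one, Finset.filter_insert]
  split_ifs
  · rw [Finset.card_insert_of_notMem (by simp)]
  · rfl

/-- The sum of the labels at a vertex where the mode switches. -/
theorem le_pathLabel_add {M : ℕ} {md : ℕ → Bool} {i : ℕ} (hi : i + 1 < 2 * M + 1)
    (hmaj : ∀ i, i ≤ 2 * ((Finset.range i).filter fun j => md j = true).card)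
    (hm : md (i + 1) ≠ md i) :
    2 * M ≤ pathLabel (2 * M + 1) md (i + 1) + pathLabel (2 * M + 1) md i + 1 := by
  have h1 := hmaj (i + 1)
  have h2 := modeCount_add md i
  have h3 := modeCount_add md (i + 1)
  have h4 := modeCount_add_modeCount_pred md true i
  rw [card_filter_range_succ] at h1
  cases hi' : md i
  · have hi2 : md (i + 1) = true := by simpa [hi'] using hm
    rw [pathLabel_false hi', pathLabel_true hi2]
    simp only [hi', Bool.false_eq_true, if_false] at h1
    split_ifs <;> omega
  · have hi2 : md (i + 1) = false := by simpa [hi'] using hm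
    rw [pathLabel_true hi', pathLabel_false hi2]
    simp only [hi', if_true] at h1
    split_ifs <;> omega

/-- The sum of the labels at a vertex where the mode switches, if it does not switch at the
preceding vertex. -/
theorem le_pathLabel_add_of_eq {M : ℕ} {md : ℕ → Bool} {i : ℕ} (hi : i + 2 < 2 * M + 1)
    (hmaj : ∀ i, i ≤ 2 * ((Finset.range i).filter fun j => md j = true).card)
    (hm : md (i + 2) ≠ md (i + 1)) (hm' : md (i + 1) = md i) :
    2 * M ≤ pathLabel (2 * M + 1) md (i + 2) + pathLabel (2 * M + 1) md (i + 1) := by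
  have h0 := hmaj i
  have h1 := hmaj (i + 2)
  have h2 := modeCount_add md (i + 1)
  have h3 := modeCount_add md (i + 2)
  have h4 : modeCount md true (i + 2) + modeCount md true (i + 1) = _ :=
    modeCount_add_modeCount_pred md true (i + 1)
  rw [card_filter_range_succ, card_filter_range_succ] at h1
  rw [card_filter_range_succ] at h4
  rw [← hm'] at h1 h4
  cases hi' : md (i + 1)
  · have hi2 : md (i + 2) = true := by simpa [hi'] using hm
    rw [pathLabel_false hi', pathLabel_true hi2]
    simp only [hi', Bool.false_eq_true, if_false] at h1 h4
    split_ifs <;> omega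
  · have hi2 : md (i + 2) = false := by simpa [hi'] using hm
    rw [pathLabel_true hi', pathLabel_false hi2]
    simp only [hi', if_true] at h1 h4
    split_ifs <;> omega

/-- If the sum at every leafless vertex involves a bottom label and the two cycle labels at every
other vertex are large, the pendant edges can be labeled. -/
theorem hasLeafyLabeling_of_cycle_labels {g : ℕ → ℝ} (hg : Admissible g) {n : ℕ} {X : Type*}
    [Fintype X] (own : X → ℕ) (H : Finset ℕ) (hH : H = Finset.univ.image own)
    (hn : ∀ x, own x < n) (x M : ℕ) (c : ℕ → ℕ) (hx : x + H.card = Fintype.card X)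
    (hM : 1 ≤ M) (hMn : M + 1 ≤ n) (hc : Set.InjOn c (Set.Iio n))
    (hcr : ∀ i < n, c i < n + Fintype.card X ∧ (x ≤ c i ∧ c i < x + M ∨ x + M + H.card ≤ c i))
    (ht : ∀ i < n, x + M + H.card ≤ c i ∨ x + M + H.card ≤ c (cyclePred n i))
    (hpp : ∀ i < n, ∀ k < n, i ∉ H → k ∉ H → i < k →
      g (c i) + g (c (cyclePred n i)) ≠ g (c k) + g (c (cyclePred n k)))
    (K : ℕ) (hpb : ∀ p < n, p ∉ H → c p ≤ K ∧ c (cyclePred n p) ≤ K ∧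
      (c p < x + M ∨ c (cyclePred n p) < x + M))
    (hh : ∀ h ∈ H, K ≤ c h + c (cyclePred n h) + 1) :
    HasLeafyLabeling g n own := by
  obtain ⟨_, ext, hext, hmain⟩ := exists_extra_leaves hg (n := n) own H hH
  have hHn : ∀ h ∈ H, h < n := by
    intro h hh
    rw [hH, Finset.mem_image] at hh
    obtain ⟨y, _, rfl⟩ := hh
    exact hn y
  set s : ℕ → ℝ := fun v => g (c v) + g (c (cyclePred n v)) + ext v with hs
  have hp : ∀ p < n, p ∉ H → g (c p) + g (c (cyclePred n p)) ≤
      g (x + M - 1) + g K := by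
    intro p hp hpH
    obtain ⟨h1, h2, h | h⟩ := hpb p hp hpH
    · have e1 := hg.mono.monotone (show c p ≤ x + M - 1 by omega)
      have e2 := hg.mono.monotone h2
      linarith
    · have e1 := hg.mono.monotone (show c (cyclePred n p) ≤ x + M - 1 by omega)
      have e2 := hg.mono.monotone h1
      linarith
  have hpw : ∀ p < n, p ∉ H → ∀ h ∈ H, g (c p) + g (c (cyclePred n p)) <
      s h + g (x + M + sortRank H s h) := by
    intro p hpn hpH h hhH
    have e1 := hp p hpn hpH
    have e2 := hh h hhH
    have e3 : 1 ≤ H.card := Finset.card_pos.2 ⟨h, hhH⟩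
    have e6 := ht h (hHn h hhH)
    have e4 := hg.add_lt_add_three (x + M - 1) K (c h)
      (c (cyclePred n h)) (x + M + sortRank H s h) (by omega) (by omega) (by omega)
    have e5 := hext h
    simp only [hs]
    linarith
  refine hmain x M c (fun v => x + M + sortRank H s v) hx hc (fun i hi => ?_) (by omega) ?_ ?_
    ht ?_
  · have := hcr i hi
    omega
  · intro u hu v hv h
    exact injOn_sortRank H s hu hv (by simpa using h)
  · intro h hhH
    have := sortRank_lt_card (s := s) hhH
    omega
  · have hin : ∀ j, j ∈ H → g (c j) + g (c (cyclePred n j)) +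
        (if j ∈ H then ext j + g (x + M + sortRank H s j) else 0) =
        s j + g (x + M + sortRank H s j) := by
      intro j hj
      rw [if_pos hj, hs]
      ring
    have hout : ∀ j, j ∉ H → g (c j) + g (c (cyclePred n j)) +
        (if j ∈ H then ext j + g (x + M + sortRank H s j) else 0) =
        g (c j) + g (c (cyclePred n j)) := by
      intro j hj
      rw [if_neg hj, add_zero]
    intro i hi k hk h
    simp only [] at h
    by_cases hiH : i ∈ H <;> by_cases hkH : k ∈ H
    · rw [hin i hiH, hin k hkH] at h
      exact injOn_add_sortRank hg.mono H s (x + M) hiH hkH h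
    · rw [hin i hiH, hout k hkH] at h
      exact absurd h (hpw k hk hkH i hiH).ne'
    · rw [hout i hiH, hin k hkH] at h
      exact absurd h (hpw i hi hiH k hkH).ne
    · rw [hout i hiH, hout k hkH] at h
      by_contra hne
      rcases lt_or_gt_of_ne hne with h' | h'
      · exact hpp i hi k hk hiH hkH h' h
      · exact hpp k hk i hi hkH hiH h' h.symm

/-- The order embedding inserting a gap of length `r` after the first `M` numbers, shifted
by `x`. -/
def gapShift (x r M l : ℕ) : ℕ := if l < M then x + l else x + r + l

theorem strictMono_gapShift (x r M : ℕ) : StrictMono (gapShift x r M) := by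
  intro i j h
  unfold gapShift
  split_ifs <;> omega

/-- Odd cycles with at least one leaf. -/
theorem hasLeafyLabeling_odd {g : ℕ → ℝ} (hg : Admissible g) {M : ℕ} (hM : 1 ≤ M) {X : Type*}
    [Fintype X] (own : X → ℕ) (H : Finset ℕ) (hH : H = Finset.univ.image own)
    (hn : ∀ x, own x < 2 * M + 1) (h0 : 0 ∈ H) (md : ℕ → Bool)
    (hflip : ∀ j, j + 1 < 2 * M + 1 → (j + 1 ∈ H ↔ md (j + 1) ≠ md j))
    (hmaj : ∀ i, i ≤ 2 * ((Finset.range i).filter fun j => md j = true).card) :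
    HasLeafyLabeling g (2 * M + 1) own := by
  obtain ⟨hle, -⟩ := exists_extra_leaves hg (n := 2 * M + 1) own H hH
  obtain ⟨x, hx⟩ : ∃ x, x + H.card = Fintype.card X := ⟨_, Nat.sub_add_cancel hle⟩
  have hdiv : (2 * M + 1) / 2 = M := by omega
  have hlt : ∀ i < 2 * M + 1, pathLabel (2 * M + 1) md i < 2 * M + 1 := fun i => pathLabel_lt md
  have heven : ∀ i < 2 * M + 1, i % 2 = 0 → M ≤ pathLabel (2 * M + 1) md i := fun i hi h => by
    simpa [hdiv] using pathLabel_even md hi h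
  have hodd : ∀ i < 2 * M + 1, i % 2 = 1 → pathLabel (2 * M + 1) md i < M := fun i hi h => by
    simpa [hdiv] using pathLabel_odd md hi h
  have hpred : ∀ j, cyclePred (2 * M + 1) (j + 1) = j := fun j => by simp [cyclePred]
  have hpos : ∀ p < 2 * M + 1, p ∉ H → ∃ j, p = j + 1 := fun p _ hp =>
    Nat.exists_eq_succ_of_ne_zero fun h => hp (h ▸ h0)
  refine hasLeafyLabeling_of_cycle_labels hg own H hH hn x M
    (fun i => gapShift x H.card M (pathLabel (2 * M + 1) md i)) hx hM (by omega) ?_ ?_ ?_ ?_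
    (x + H.card + 2 * M) ?_ ?_
  · intro i hi k hk h
    exact injOn_pathLabel _ md hi hk ((strictMono_gapShift _ _ _).injective h)
  · intro i hi
    have := hlt i hi
    simp only [gapShift]
    split_ifs <;> omega
  · intro i hi
    rcases Nat.eq_zero_or_pos i with rfl | h
    · have := heven 0 hi rfl
      left
      simp only [gapShift]
      split_ifs <;> omega
    · obtain ⟨j, rfl⟩ : ∃ j, i = j + 1 := ⟨i - 1, by omega⟩
      simp only [hpred, gapShift]
      rcases Nat.mod_two_eq_zero_or_one j with h | h
      · have := heven j (by omega) h
        right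
        split_ifs <;> omega
      · have := heven (j + 1) hi (by omega)
        left
        split_ifs <;> omega
  · intro i hi k hk hiH hkH hik
    obtain ⟨i, rfl⟩ := hpos i hi hiH
    obtain ⟨k, rfl⟩ := hpos k hk hkH
    rw [hflip i hi, not_not] at hiH
    simp only [hpred]
    exact pathLabel_sum_ne (hg.mono.comp (strictMono_gapShift x H.card M))
      (by omega) hk hiH
  · intro p hp hpH
    obtain ⟨j, rfl⟩ := hpos p hp hpH
    simp only [hpred, gapShift]
    have := hlt j (by omega)
    have := hlt (j + 1) hp
    rcases Nat.mod_two_eq_zero_or_one j with h | h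
    · have := hodd (j + 1) hp (by omega)
      split_ifs <;> omega
    · have := hodd j (by omega) h
      split_ifs <;> omega
  · intro h hhH
    have hh : h < 2 * M + 1 := by
      rw [hH, Finset.mem_image] at hhH
      obtain ⟨y, _, rfl⟩ := hhH
      exact hn y
    rcases Nat.eq_zero_or_pos h with rfl | h'
    · have e1 := heven 0 hh rfl
      have e2 := heven (2 * M) (by omega) (by omega)
      have e3 : pathLabel (2 * M + 1) md 0 ≠ pathLabel (2 * M + 1) md (2 * M) := by
        intro h
        have := injOn_pathLabel (2 * M + 1) md (x₁ := 0) (x₂ := 2 * M) (by simp) (by simp) h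
        omega
      simp only [gapShift, cyclePred, if_true, Nat.add_sub_cancel]
      split_ifs <;> omega
    · obtain ⟨j, rfl⟩ : ∃ j, h = j + 1 := ⟨h - 1, by omega⟩
      have e1 := le_pathLabel_add hh hmaj ((hflip j hh).1 hhH)
      simp only [gapShift, hpred]
      rcases Nat.mod_two_eq_zero_or_one j with h | h
      · have := heven j (by omega) h
        have := hodd (j + 1) hh (by omega)
        split_ifs <;> omega
      · have := hodd j (by omega) h
        have := heven (j + 1) hh (by omega)
        split_ifs <;> omega

theorem modeCount_const_true (i : ℕ) : modeCount (fun _ => true) true i = i / 2 := by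
  have h := modeCount_add (fun _ => true) i
  have : modeCount (fun _ => true) false i = 0 := by simp [modeCount]
  omega

/-- Even cycles with exactly one or two vertices having leaves. -/
theorem hasLeafyLabeling_even_of_card_le_two {g : ℕ → ℝ} (hg : Admissible g) {M : ℕ} (hM : 1 ≤ M)
    {X : Type*} [Fintype X] (own : X → ℕ) (H : Finset ℕ) (hH : H = Finset.univ.image own)
    (hn : ∀ x, own x < 2 * M) (h0 : 0 ∈ H) (hfar : ∀ h ∈ H, h = 0 ∨ M ≤ h) :
    HasLeafyLabeling g (2 * M) own := by
  obtain ⟨hle, -⟩ := exists_extra_leaves hg (n := 2 * M) own H hH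
  obtain ⟨x, hx⟩ : ∃ x, x + H.card = Fintype.card X := ⟨_, Nat.sub_add_cancel hle⟩
  set md : ℕ → Bool := fun _ => true with hmd
  have hl : ∀ i, pathLabel (2 * M) md i = (if i % 2 = 0 then M else 0) + i / 2 := fun i => by
    rw [pathLabel_true rfl, modeCount_const_true]
    simp
  have hpred : ∀ j, cyclePred (2 * M) (j + 1) = j := fun j => by simp [cyclePred]
  have hpos : ∀ p < 2 * M, p ∉ H → ∃ j, p = j + 1 := fun p _ hp =>
    Nat.exists_eq_succ_of_ne_zero fun h => hp (h ▸ h0)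
  refine hasLeafyLabeling_of_cycle_labels hg own H hH hn x M
    (fun i => gapShift x H.card M (pathLabel (2 * M) md i)) hx hM (by omega) ?_ ?_ ?_ ?_
    (x + H.card + 2 * M - 1) ?_ ?_
  · intro i hi k hk h
    exact injOn_pathLabel _ md hi hk ((strictMono_gapShift _ _ _).injective h)
  · intro i hi
    have := hl i
    simp only [gapShift]
    split_ifs at * <;> omega
  · intro i hi
    rcases Nat.eq_zero_or_pos i with rfl | h
    · have := hl 0
      left
      simp only [gapShift]
      split_ifs at * <;> omega
    · obtain ⟨j, rfl⟩ : ∃ j, i = j + 1 := ⟨i - 1, by omega⟩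
      simp only [hpred, gapShift]
      have := hl j
      have := hl (j + 1)
      rcases Nat.mod_two_eq_zero_or_one j with h | h
      · right
        split_ifs at * <;> omega
      · left
        split_ifs at * <;> omega
  · intro i hi k hk hiH hkH hik
    obtain ⟨i, rfl⟩ := hpos i hi hiH
    obtain ⟨k, rfl⟩ := hpos k hk hkH
    simp only [hpred]
    exact pathLabel_sum_ne (hg.mono.comp (strictMono_gapShift x H.card M))
      (by omega) hk rfl
  · intro p hp hpH
    obtain ⟨j, rfl⟩ := hpos p hp hpH
    simp only [hpred, gapShift]
    have := hl j
    have := hl (j + 1)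
    split_ifs at * <;> omega
  · intro h hhH
    have hh : h < 2 * M := by
      rw [hH, Finset.mem_image] at hhH
      obtain ⟨y, _, rfl⟩ := hhH
      exact hn y
    rcases hfar h hhH with rfl | h'
    · have e1 := hl 0
      have e2 := hl (2 * M - 1)
      simp only [gapShift, cyclePred, if_true]
      rw [if_neg (by omega)] at e2
      split_ifs at * <;> omega
    · obtain ⟨j, rfl⟩ : ∃ j, h = j + 1 := ⟨h - 1, by omega⟩
      have e1 := hl j
      have e2 := hl (j + 1)
      simp only [gapShift, hpred]
      rcases Nat.mod_two_eq_zero_or_one j with h | h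
      · split_ifs at * <;> omega
      · split_ifs at * <;> omega

/-- Even cycles with two adjacent vertices having leaves: the edge `w` between them gets the
largest label, and the others are labeled as in the odd cycle obtained by contracting it. -/
theorem hasLeafyLabeling_even_of_adjacent {g : ℕ → ℝ} (hg : Admissible g) {M : ℕ} (hM : 1 ≤ M)
    {X : Type*} [Fintype X] (own : X → ℕ) (H : Finset ℕ) (hH : H = Finset.univ.image own)
    (hn : ∀ x, own x < 2 * M + 2) (h0 : 0 ∈ H) {w : ℕ} (hw1 : 1 ≤ w) (hw2 : w ≤ 2 * M + 1)
    (hw : w ∈ H) (hw' : w < 2 * M + 1 → w + 1 ∈ H) (md : ℕ → Bool)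
    (hflip : ∀ j, j + 1 < 2 * M + 1 →
      ((if j + 1 < w then j + 1 else j + 2) ∈ H ↔ md (j + 1) ≠ md j))
    (hmaj : ∀ i, i ≤ 2 * ((Finset.range i).filter fun j => md j = true).card) :
    HasLeafyLabeling g (2 * M + 2) own := by
  obtain ⟨hle, -⟩ := exists_extra_leaves hg (n := 2 * M + 2) own H hH
  obtain ⟨x, hx⟩ : ∃ x, x + H.card = Fintype.card X := ⟨_, Nat.sub_add_cancel hle⟩
  have hdiv : (2 * M + 1) / 2 = M := by omega
  set l : ℕ → ℕ := pathLabel (2 * M + 1) md with hl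
  have hlt : ∀ i < 2 * M + 1, l i < 2 * M + 1 := fun i => pathLabel_lt md
  have heven : ∀ i < 2 * M + 1, i % 2 = 0 → M ≤ l i := fun i hi h => by
    simpa [hdiv] using pathLabel_even md hi h
  have hodd : ∀ i < 2 * M + 1, i % 2 = 1 → l i < M := fun i hi h => by
    simpa [hdiv] using pathLabel_odd md hi h
  have hinj : ∀ i < 2 * M + 1, ∀ k < 2 * M + 1, l i = l k → i = k := fun i hi k hk h =>
    injOn_pathLabel (2 * M + 1) md hi hk h
  have hpred : ∀ j, cyclePred (2 * M + 2) (j + 1) = j := fun j => by simp [cyclePred]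
  set G : ℕ → ℕ := gapShift x H.card M with hG
  have hGr : ∀ l, l < 2 * M + 1 → G l < x + H.card + 2 * M + 1 ∧ x ≤ G l := by
    intro l h
    simp only [hG, gapShift]
    split_ifs <;> omega
  have hGt : ∀ l, M ≤ l → G l = x + H.card + l := by
    intro l h
    simp only [hG, gapShift, if_neg (not_lt.2 h)]
  have hGb : ∀ l, l < M → G l = x + l := by
    intro l h
    simp only [hG, gapShift, if_pos h]
  set c : ℕ → ℕ := fun j => if j < w then G (l j) else if j = w then x + H.card + 2 * M + 1
    else G (l (j - 1)) with hc
  have hc1 : ∀ j, j < w → c j = G (l j) := fun j h => by simp [hc, h]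
  have hc2 : c w = x + H.card + 2 * M + 1 := by simp [hc]
  have hc3 : ∀ j, w < j → c j = G (l (j - 1)) := fun j h => by
    simp only [hc]; rw [if_neg (by omega), if_neg (by omega)]
  have hcase : ∀ j < 2 * M + 2, j = 0 ∧ w < 2 * M + 1 ∨ c j = x + H.card + 2 * M + 1 ∨
      c (cyclePred (2 * M + 2) j) = x + H.card + 2 * M + 1 ∨
      ∃ i, i + 1 < 2 * M + 1 ∧ j = (if i + 1 < w then i + 1 else i + 2) ∧ c j = G (l (i + 1)) ∧
        c (cyclePred (2 * M + 2) j) = G (l i) := by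
    intro j hj
    rcases Nat.eq_zero_or_pos j with rfl | hpos
    · by_cases h : w < 2 * M + 1
      · exact Or.inl ⟨rfl, h⟩
      · right; right; left
        have : cyclePred (2 * M + 2) 0 = w := by simp only [cyclePred, if_true]; omega
        rw [this, hc2]
    · right
      obtain ⟨k, rfl⟩ : ∃ k, j = k + 1 := ⟨j - 1, by omega⟩
      rw [hpred]
      rcases lt_trichotomy (k + 1) w with h | h | h
      · right; right
        exact ⟨k, by omega, by rw [if_pos h], hc1 _ h, hc1 _ (by omega)⟩
      · left
        rw [h, hc2]
      · right
        rcases eq_or_lt_of_le (show w ≤ k by omega) with h' | h'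
        · left
          rw [← h', hc2]
        · right
          obtain ⟨i, rfl⟩ : ∃ i, k = i + 1 := ⟨k - 1, by omega⟩
          refine ⟨i, by omega, by rw [if_neg (by omega)], ?_, ?_⟩
          · rw [hc3 _ h]; rfl
          · rw [hc3 _ h']; rfl
  have hcaseP : ∀ j < 2 * M + 2, j ∉ H →
      ∃ i, i + 1 < 2 * M + 1 ∧ j = (if i + 1 < w then i + 1 else i + 2) ∧ c j = G (l (i + 1)) ∧
        c (cyclePred (2 * M + 2) j) = G (l i) := by
    intro j hj hjH
    have hcw : ∀ j < 2 * M + 2, c j = x + H.card + 2 * M + 1 → j = w := by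
      intro j hj h
      rcases lt_trichotomy j w with h1 | h1 | h1
      · rw [hc1 j h1] at h
        have := hGr _ (hlt j (by omega))
        omega
      · exact h1
      · rw [hc3 j h1] at h
        have := hGr _ (hlt (j - 1) (by omega))
        omega
    rcases hcase j hj with h | h | h | h
    · exact absurd (h.1 ▸ h0) hjH
    · exact absurd (hcw j hj h ▸ hw) hjH
    · have := hcw _ (cyclePred_lt hj) h
      exfalso
      apply hjH
      rcases Nat.eq_zero_or_pos j with rfl | hpos
      · exact h0
      · obtain ⟨k, rfl⟩ : ∃ k, j = k + 1 := ⟨j - 1, by omega⟩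
        rw [hpred] at this
        rw [this]
        exact hw' (by omega)
    · exact h
  have hGinj : ∀ i < 2 * M + 1, ∀ k < 2 * M + 1, G (l i) = G (l k) → i = k :=
    fun i hi k hk h => hinj i hi k hk ((strictMono_gapShift _ _ _).injective h)
  refine hasLeafyLabeling_of_cycle_labels hg own H hH hn x M c hx hM (by omega) ?_ ?_ ?_ ?_
    (x + H.card + 2 * M) ?_ ?_
  · have key : ∀ i k, i < k → k < 2 * M + 2 → c i ≠ c k := by
      intro i k hik hk h
      rcases lt_trichotomy i w with h1 | h1 | h1 <;> rcases lt_trichotomy k w with h2 | h2 | h2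
      · rw [hc1 i h1, hc1 k h2] at h
        have := hGinj i (by omega) k (by omega) h
        omega
      · rw [hc1 i h1, h2, hc2] at h
        have := hGr _ (hlt i (by omega))
        omega
      · rw [hc1 i h1, hc3 k h2] at h
        have := hGinj i (by omega) (k - 1) (by omega) h
        omega
      · omega
      · omega
      · rw [h1, hc2, hc3 k h2] at h
        have := hGr _ (hlt (k - 1) (by omega))
        omega
      · omega
      · omega
      · rw [hc3 i h1, hc3 k h2] at h
        have := hGinj (i - 1) (by omega) (k - 1) (by omega) h
        omega
    intro i hi k hk h
    by_contra hne
    rcases lt_or_gt_of_ne hne with h' | h'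
    · exact key i k h' hk h
    · exact key k i h' hi h.symm
  · intro i hi
    have hcr : ∀ l, l < 2 * M + 1 → x ≤ G l ∧ G l < x + M ∨ x + M + H.card ≤ G l := by
      intro l h
      simp only [hG, gapShift]
      split_ifs <;> omega
    rcases lt_trichotomy i w with h | h | h
    · rw [hc1 i h]
      have := hlt i (by omega)
      have := hGr _ this
      exact ⟨by omega, hcr _ (by omega)⟩
    · rw [h, hc2]
      omega
    · rw [hc3 i h]
      have := hlt (i - 1) (by omega)
      have := hGr _ this
      exact ⟨by omega, hcr _ (by omega)⟩
  · intro j hj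
    rcases hcase j hj with h | h | h | ⟨i, hi, hji, h1, h2⟩
    · left
      rw [h.1, hc1 0 hw1]
      have := heven 0 (by omega) rfl
      rw [hGt _ this]
      omega
    · left; omega
    · right; omega
    · rw [h1, h2]
      rcases Nat.mod_two_eq_zero_or_one i with h | h
      · right
        have := heven i (by omega) h
        rw [hGt _ this]; omega
      · left
        have := heven (i + 1) hi (by omega)
        rw [hGt _ this]; omega
  · intro j hj k hk hjH hkH hjk
    obtain ⟨i, hi, hji, h1, h2⟩ := hcaseP j hj hjH
    obtain ⟨i', hi', hki, h3, h4⟩ := hcaseP k hk hkH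
    rw [h1, h2, h3, h4]
    rw [hji, hflip i hi, not_not] at hjH
    refine pathLabel_sum_ne (hg.mono.comp (strictMono_gapShift x H.card M)) ?_ hi' hjH
    split_ifs at hji hki <;> omega
  · intro j hj hjH
    obtain ⟨i, hi, hji, h1, h2⟩ := hcaseP j hj hjH
    rw [h1, h2]
    have := (hGr _ (hlt (i + 1) hi)).1
    have := (hGr _ (hlt i (by omega))).1
    refine ⟨by omega, by omega, ?_⟩
    rcases Nat.mod_two_eq_zero_or_one i with h | h
    · left
      have := hodd (i + 1) hi (by omega)
      rw [hGb _ this]; omega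
    · right
      have := hodd i (by omega) h
      rw [hGb _ this]; omega
  · intro j hjH
    have hj : j < 2 * M + 2 := by
      rw [hH, Finset.mem_image] at hjH
      obtain ⟨y, _, rfl⟩ := hjH
      exact hn y
    have hcx : ∀ j < 2 * M + 2, x ≤ c j := by
      intro j hj
      rcases lt_trichotomy j w with h | h | h
      · rw [hc1 j h]
        exact (hGr _ (hlt _ (by omega))).2
      · rw [h, hc2]; omega
      · rw [hc3 j h]
        exact (hGr _ (hlt _ (by omega))).2
    rcases hcase j hj with h | h | h | ⟨i, hi, hji, h1, h2⟩
    · have e0 : cyclePred (2 * M + 2) 0 = 2 * M + 1 := by simp [cyclePred]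
      rw [h.1, e0, hc1 0 hw1, hc3 _ h.2, Nat.add_sub_cancel]
      have e1 := heven 0 (by omega) rfl
      have e2 := heven (2 * M) (by omega) (by omega)
      have e3 : l 0 ≠ l (2 * M) := by
        intro h
        have := hinj 0 (by omega) (2 * M) (by omega) h
        omega
      rw [hGt _ e1, hGt _ e2]
      omega
    · have := hcx _ (cyclePred_lt hj)
      omega
    · have := hcx j hj
      omega
    · rw [h1, h2]
      rw [hji, hflip i hi] at hjH
      have e1 := le_pathLabel_add hi hmaj hjH
      rw [← hl] at e1
      rcases Nat.mod_two_eq_zero_or_one i with h | h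
      · have e2 := heven i (by omega) h
        have e3 := hodd (i + 1) hi (by omega)
        rw [hGt _ e2, hGb _ e3]
        omega
      · have e2 := hodd i (by omega) h
        have e3 := heven (i + 1) hi (by omega)
        rw [hGb _ e2, hGt _ e3]
        omega

/-- Cycles without leaves. -/
theorem hasLeafyLabeling_of_isEmpty {g : ℕ → ℝ} (hg : Admissible g) {n : ℕ} (hn : 3 ≤ n)
    {X : Type*} [Fintype X] [IsEmpty X] (own : X → ℕ) : HasLeafyLabeling g n own := by
  set c : ℕ → ℕ := fun i => if 2 * i < n then 2 * i else 2 * (n - i) - 1 with hc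
  set D : ℕ → ℝ := fun t => g (t - 1) + g (min (t + 1) (n - 1)) with hD
  have hDmono : ∀ t t', t < t' → t' < n → D t < D t' := by
    intro t t' h h'
    simp only [hD]
    rcases Nat.eq_zero_or_pos t with rfl | ht
    · have h1 := hg.mono.monotone (show 0 - 1 ≤ t' - 1 by omega)
      have h2 := hg.mono (show min (0 + 1) (n - 1) < min (t' + 1) (n - 1) by omega)
      linarith
    · have h1 := hg.mono (show t - 1 < t' - 1 by omega)
      have h2 := hg.mono.monotone (show min (t + 1) (n - 1) ≤ min (t' + 1) (n - 1) by omega)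
      linarith
  set ρ : ℕ → ℕ := fun j => if j = 0 then 0 else if 2 * j < n then 2 * j - 1 else
    if n ≤ 2 * (j - 1) then 2 * (n - j) else n - 1 with hρ
  have hρn : ∀ j < n, ρ j < n := by
    intro j hj
    simp only [hρ]
    split_ifs <;> omega
  have hρinj : ∀ j < n, ∀ k < n, ρ j = ρ k → j = k := by
    intro j hj k hk h
    simp only [hρ] at h
    split_ifs at h <;> omega
  have hcD : ∀ j < n, g (c j) + g (c (cyclePred n j)) = D (ρ j) := by
    intro j hj
    have hsum : ∀ a b a' b', (a = a' ∧ b = b') ∨ (a = b' ∧ b = a') →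
        g a + g b = g a' + g b' := by
      rintro a b a' b' (⟨rfl, rfl⟩ | ⟨rfl, rfl⟩)
      · rfl
      · ring
    apply hsum
    simp only [hc, hρ, cyclePred]
    split_ifs <;> omega
  refine ⟨c, fun y => isEmptyElim y, ?_, fun y => isEmptyElim y, fun _ _ y => isEmptyElim y, ?_,
    fun y => isEmptyElim y, ?_, fun _ _ y => isEmptyElim y⟩
  · intro i hi k hk h
    simp only [Set.mem_Iio] at hi hk
    simp only [hc] at h
    split_ifs at h <;> omega
  · intro i hi
    simp only [hc]
    split_ifs <;> omega
  · intro i hi k hk h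
    simp only [Finset.univ_eq_empty, Finset.filter_empty, Finset.sum_empty, add_zero] at h
    rw [hcD i hi, hcD k hk] at h
    by_contra hne
    rcases lt_or_gt_of_ne (fun h' => hne (hρinj i hi k hk h')) with h' | h'
    · exact (hDmono _ _ h' (hρn k hk)).ne h
    · exact (hDmono _ _ h' (hρn i hi)).ne h.symm

/-- The order embedding `gapShift x r M` followed by skipping the value `x + r + M + q`. -/
def gapShiftSkip (x r M q l : ℕ) : ℕ :=
  if l < M then x + l else if l < M + q then x + r + l else x + r + l + 1

theorem strictMono_gapShiftSkip (x r M q : ℕ) : StrictMono (gapShiftSkip x r M q) := by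
  intro i j h
  unfold gapShiftSkip
  split_ifs <;> omega

/-- Even cycles with at least three vertices having leaves, no two of them adjacent. -/
theorem hasLeafyLabeling_even_of_not_adjacent {g : ℕ → ℝ} (hg : Admissible g) {M : ℕ}
    (hM : 1 ≤ M) {X : Type*} [Fintype X] (own : X → ℕ) (H : Finset ℕ)
    (hH : H = Finset.univ.image own) (hn : ∀ x, own x < 2 * M + 2) (h0 : 0 ∈ H)
    (hcard : 3 ≤ H.card) (hadj : ∀ j, j + 1 ∈ H → j ∉ H) (hlast : 2 * M + 1 ∉ H) (md : ℕ → Bool)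
    (hmd0 : md 0 = true) (hflip : ∀ j, j + 1 < 2 * M + 2 → (j + 1 ∈ H ↔ md (j + 1) ≠ md j))
    (hmaj : ∀ i, i ≤ 2 * ((Finset.range i).filter fun j => md j = true).card) :
    HasLeafyLabeling g (2 * M + 2) own := by
  obtain ⟨hle, ext, hext, hmain⟩ := exists_extra_leaves hg (n := 2 * M + 2) own H hH
  obtain ⟨x, hx⟩ : ∃ x, x + H.card = Fintype.card X := ⟨_, Nat.sub_add_cancel hle⟩
  have hHn : ∀ h ∈ H, h < 2 * M + 1 := by
    intro h hh
    have hne : h ≠ 2 * M + 1 := fun h' => hlast (h' ▸ hh)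
    rw [hH, Finset.mem_image] at hh
    obtain ⟨y, _, rfl⟩ := hh
    have := hn y
    omega
  have hdiv : (2 * M + 1) / 2 = M := by omega
  set l : ℕ → ℕ := pathLabel (2 * M + 1) md with hl
  have hlt : ∀ i < 2 * M + 1, l i < 2 * M + 1 := fun i => pathLabel_lt md
  have heven : ∀ i < 2 * M + 1, i % 2 = 0 → M ≤ l i := fun i hi h => by
    simpa [hdiv] using pathLabel_even md hi h
  have hodd : ∀ i < 2 * M + 1, i % 2 = 1 → l i < M := fun i hi h => by
    simpa [hdiv] using pathLabel_odd md hi h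
  have hinj : ∀ i < 2 * M + 1, ∀ k < 2 * M + 1, l i = l k → i = k := fun i hi k hk h =>
    injOn_pathLabel (2 * M + 1) md hi hk h
  have hl0 : l 0 = M := by
    rw [hl, pathLabel_true hmd0]
    simp [modeCount, hdiv]
  have hfalse : ∃ j < 2 * M, j % 2 = 0 ∧ md j = false := by
    set O := H.erase 0 with hO
    have hOc : 2 ≤ O.card := by rw [hO, Finset.card_erase_of_mem h0]; omega
    have hOne : O.Nonempty := Finset.card_pos.1 (by omega)
    obtain ⟨i, hi, himin⟩ := O.exists_min_image id hOne
    obtain ⟨k, hk, hki⟩ := Finset.exists_mem_ne (by omega : 1 < O.card) i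
    have hik : i < k := lt_of_le_of_ne (himin k hk) hki.symm
    obtain ⟨hi0, hiH⟩ := Finset.mem_erase.1 hi
    have hkH := (Finset.mem_erase.1 hk).2
    have hkn := hHn k hkH
    have hk1 : k ≠ i + 1 := fun h => hadj i (h ▸ hkH) hiH
    have htrue : ∀ j < i, md j = true := by
      intro j
      induction j with
      | zero => exact fun _ => hmd0
      | succ j ih =>
        intro h
        have h1 : j + 1 ∉ H := fun h' => absurd (himin (j + 1)
          (Finset.mem_erase.2 ⟨by omega, h'⟩)) (by simpa using h)
        rw [hflip j (by omega), not_not] at h1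
        rw [h1]
        exact ih (by omega)
    obtain ⟨i', rfl⟩ := Nat.exists_eq_succ_of_ne_zero hi0
    have e1 : md (i' + 1) = false := by
      have := (hflip i' (by omega)).1 hiH
      rw [htrue i' (by omega)] at this
      simpa using this
    have e2 : md (i' + 2) = false := by
      have h1 : i' + 1 + 1 ∉ H := fun h => hadj _ h hiH
      rw [hflip (i' + 1) (by omega), not_not] at h1
      rw [← e1]
      exact h1
    rcases Nat.mod_two_eq_zero_or_one i' with h | h
    · exact ⟨i' + 2, by omega, by omega, e2⟩
    · exact ⟨i' + 1, by omega, by omega, e1⟩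
  have hllast : l (2 * M) < 2 * M := by
    obtain ⟨j, hj, hj2, hjm⟩ := hfalse
    have h1 := modeCount_add md (2 * M)
    have h2 : 1 ≤ modeCount md false (2 * M) :=
      Finset.card_pos.2 ⟨j, Finset.mem_filter.2 ⟨Finset.mem_range.2 hj, by omega, hjm⟩⟩
    rw [hl]
    cases hm : md (2 * M)
    · rw [pathLabel_false hm]; split_ifs <;> omega
    · rw [pathLabel_true hm]; split_ifs <;> omega
  have hllast' : M ≤ l (2 * M) := heven _ (by omega) (by omega)
  have hcardM : H.card ≤ M + 1 := by
    have := Finset.card_le_card_of_injOn (s := H) (t := Finset.range (M + 1)) (fun h => h / 2)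
      (fun h hh => by
        have := hHn h hh
        simp only [Finset.coe_range, Set.mem_Iio]
        omega) (fun a ha b hb h => by
        simp only at h
        by_contra hne
        rcases (by omega : b = a + 1 ∨ a = b + 1) with h' | h'
        · exact hadj a (h' ▸ hb) ha
        · exact hadj b (h' ▸ ha) hb)
    simpa using this
  set c : ℕ → ℕ → ℕ := fun q i => if i = 2 * M + 1 then x + H.card + M + q else
    gapShiftSkip x H.card M q (l i) with hc
  have hcN : ∀ q, c q (2 * M + 1) = x + H.card + M + q := fun q => by simp [hc]
  have hcP : ∀ q i, i < 2 * M + 1 → c q i = gapShiftSkip x H.card M q (l i) := fun q i hi => by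
    simp [hc, hi.ne]
  have hpred : ∀ j, cyclePred (2 * M + 2) (j + 1) = j := fun j => by simp [cyclePred]
  have hpred0 : cyclePred (2 * M + 2) 0 = 2 * M + 1 := by simp [cyclePred]
  set v : ℕ → ℕ → ℝ := fun q j => g (c q j) + g (c q (cyclePred (2 * M + 2) j)) with hv
  have hvS : ∀ q j, v q (j + 1) = g (c q (j + 1)) + g (c q j) := fun q j => by
    simp only [hv, hpred]
  have hv0 : ∀ q, v q 0 = g (c q 0) + g (c q (2 * M + 1)) := fun q => by
    simp only [hv, hpred0]
  set O := H.erase 0 with hO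
  have hOH : insert 0 O = H := Finset.insert_erase h0
  have hOcard : O.card + 1 = H.card := by rw [hO]; exact Finset.card_erase_add_one h0
  have hOpos : ∀ o ∈ O, ∃ i, o = i + 2 ∧ i + 2 < 2 * M + 1 := by
    intro o ho
    obtain ⟨h1, h2⟩ := Finset.mem_erase.1 ho
    have h3 := hHn o h2
    have h4 : o ≠ 1 := fun h => hadj 0 (by simpa [h] using h2) h0
    exact ⟨o - 2, by omega, by omega⟩
  set Q := (Finset.Icc (M + 1 - H.card) (M + 1)).erase (l (2 * M) - M) with hQ
  have hQcard : O.card < Q.card := by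
    have := Finset.pred_card_le_card_erase (s := Finset.Icc (M + 1 - H.card) (M + 1))
      (a := l (2 * M) - M)
    rw [Nat.card_Icc, ← hQ] at this
    omega
  have hQm : ∀ q ∈ Q, q ≠ l (2 * M) - M ∧ M + 1 - H.card ≤ q ∧ q ≤ M + 1 := by
    intro q hq
    obtain ⟨h1, h2⟩ := Finset.mem_erase.1 hq
    rw [Finset.mem_Icc] at h2
    exact ⟨h1, h2⟩
  obtain ⟨q, hqQ, hq⟩ := exists_no_collision hg.mono (O := O) (Q := Q) (by simp [hO]) hQcard
    (fun q j => v q j + ext j) (fun q => v q (2 * M + 1)) (x + M)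
    (by
      intro q hq q' hq' h
      obtain ⟨h1, -, -⟩ := hQm q hq
      simp only [hvS, hcN]
      rw [hcP q _ (by omega), hcP q' _ (by omega)]
      by_cases hcase : M + q ≤ l (2 * M) ∧ l (2 * M) < M + q'
      · have e1 := hg.mono (show x + H.card + M + q < gapShiftSkip x H.card M q' (l (2 * M)) by
          unfold gapShiftSkip; split_ifs <;> omega)
        have e2 := hg.mono.monotone (show gapShiftSkip x H.card M q (l (2 * M)) ≤
          x + H.card + M + q' by unfold gapShiftSkip; split_ifs <;> omega)
        linarith
      · have e1 := hg.mono (show x + H.card + M + q < x + H.card + M + q' by omega)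
        have e2 : gapShiftSkip x H.card M q (l (2 * M)) =
            gapShiftSkip x H.card M q' (l (2 * M)) := by
          unfold gapShiftSkip; split_ifs <;> omega
        rw [e2]
        linarith)
    (by
      intro q _ q' _ h o ho
      obtain ⟨i, rfl, hi⟩ := hOpos o ho
      simp only [hvS]
      rw [hcP q _ hi, hcP q' _ hi, hcP q _ (by omega), hcP q' _ (by omega)]
      have e1 : ∀ t, g (gapShiftSkip x H.card M q' t) ≤ g (gapShiftSkip x H.card M q t) :=
        fun t => hg.mono.monotone (by unfold gapShiftSkip; split_ifs <;> omega)
      linarith [e1 (l (i + 2)), e1 (l (i + 1))])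
    (by
      intro q _ q' _ h
      simp only [hv0, hcN]
      rw [hcP q _ (by omega), hcP q' _ (by omega), hl0]
      have e1 : gapShiftSkip x H.card M q' M = x + H.card + M := by
        unfold gapShiftSkip; split_ifs <;> omega
      rw [e1]
      rcases Nat.eq_zero_or_pos q with rfl | hq
      · have e2 : gapShiftSkip x H.card M 0 M = x + H.card + M + 1 := by
          unfold gapShiftSkip; split_ifs <;> omega
        rw [e2]
        have := hg.mono.monotone (show x + H.card + M + 1 ≤ x + H.card + M + q' by omega)
        simp only [add_zero]
        linarith
      · have e2 : gapShiftSkip x H.card M q M = x + H.card + M := by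
          unfold gapShiftSkip; split_ifs <;> omega
        rw [e2]
        have := hg.mono.monotone (show x + H.card + M + q ≤ x + H.card + M + q' by omega)
        linarith)
  obtain ⟨hq1, hq2, hq3⟩ := hQm q hqQ
  rw [hOH] at hq
  set s : ℕ → ℝ := fun j => v q j + ext j with hs
  have hTop : ∀ t, M ≤ t → t < 2 * M + 1 → x + H.card + t ≤ gapShiftSkip x H.card M q t ∧
      gapShiftSkip x H.card M q t ≤ x + H.card + t + 1 := by
    intro t h1 h2
    unfold gapShiftSkip; split_ifs <;> omega
  have hBot : ∀ t, t < M → gapShiftSkip x H.card M q t = x + t := by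
    intro t h
    unfold gapShiftSkip; split_ifs; omega
  have hTB : ∀ i, i + 1 < 2 * M + 1 →
      v q (i + 1) ≤ g (x + M - 1) + g (x + H.card + 2 * M + 1) := by
    intro i hi
    rw [hvS, hcP q _ hi, hcP q _ (by omega)]
    rcases Nat.mod_two_eq_zero_or_one i with h | h
    · have e1 := heven i (by omega) h
      have e2 := hodd (i + 1) hi (by omega)
      have e3 := hTop _ e1 (hlt i (by omega))
      have e4 := hlt i (by omega)
      have e5 := hg.mono.monotone (show gapShiftSkip x H.card M q (l i) ≤
        x + H.card + 2 * M + 1 by omega)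
      have e6 := hg.mono.monotone (show x + l (i + 1) ≤ x + M - 1 by omega)
      rw [hBot _ e2]
      linarith
    · have e1 := heven (i + 1) hi (by omega)
      have e2 := hodd i (by omega) h
      have e3 := hTop _ e1 (hlt (i + 1) hi)
      have e4 := hlt (i + 1) hi
      have e5 := hg.mono.monotone (show gapShiftSkip x H.card M q (l (i + 1)) ≤
        x + H.card + 2 * M + 1 by omega)
      have e6 := hg.mono.monotone (show x + l i ≤ x + M - 1 by omega)
      rw [hBot _ e2]
      linarith
  have hTlast := hTop _ hllast' (by omega)
  have hNbig : g (x + M - 1) + g (x + H.card + 2 * M + 1) < v q (2 * M + 1) := by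
    rw [hvS, hcN, hcP q _ (by omega)]
    exact hg.add_lt_add_two _ _ _ _ (by omega) (by omega) (by omega)
  have hT0 := hTop M le_rfl (by omega)
  have hHbig : ∀ h ∈ H, g (x + M - 1) + g (x + H.card + 2 * M + 1) <
      s h + g (x + M + sortRank H s h) := by
    intro h hh
    have e5 := hext h
    suffices g (x + M - 1) + g (x + H.card + 2 * M + 1) <
        v q h + g (x + M + sortRank H s h) by
      simp only [hs] at this ⊢
      linarith
    rcases Nat.eq_zero_or_pos h with rfl | hpos
    · rw [hv0, hcN, hcP q _ (by omega), hl0]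
      exact hg.add_lt_add_three _ _ _ _ _ (by omega) (by omega) (by omega)
    · obtain ⟨i, rfl, hi⟩ := hOpos h (Finset.mem_erase.2 ⟨by omega, hh⟩)
      have f1 := (hflip (i + 1) (by omega)).1 hh
      have f2 : md (i + 1) = md i := by
        have := hadj (i + 1) hh
        rwa [hflip i (by omega), not_not] at this
      have f3 := le_pathLabel_add_of_eq hi hmaj f1 f2
      rw [← hl] at f3
      rw [show i + 2 = (i + 1) + 1 from rfl, hvS, hcP q _ hi, hcP q _ (by omega)]
      rcases Nat.mod_two_eq_zero_or_one i with h | h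
      · have e1 := heven (i + 2) hi (by omega)
        have e2 := hodd (i + 1) (by omega) (by omega)
        have e3 := hTop _ e1 (hlt _ hi)
        have e4 := hBot _ e2
        exact hg.add_lt_add_three _ _ _ _ _ (by omega) (by omega) (by omega)
      · have e1 := heven (i + 1) (by omega) (by omega)
        have e2 := hodd (i + 2) hi (by omega)
        have e3 := hTop _ e1 (hlt _ (by omega))
        have e4 := hBot _ e2
        exact hg.add_lt_add_three _ _ _ _ _ (by omega) (by omega) (by omega)
  have hN0 : v q (2 * M + 1) < s 0 + g (x + M + sortRank H s 0) := by
    have e5 := hext 0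
    simp only [hs]
    rw [hv0, hvS, hcP q (2 * M) (by omega), hcP q 0 (by omega), hl0]
    have e1 := hg.superadd (gapShiftSkip x H.card M q M) (x + M + sortRank H s 0)
      (by omega) (by omega)
    have e2 := hg.mono.monotone (show gapShiftSkip x H.card M q (l (2 * M)) ≤
      gapShiftSkip x H.card M q M + (x + M + sortRank H s 0) by omega)
    simp only [hs] at e1 e2
    linarith
  have hNH : ∀ h ∈ H, v q (2 * M + 1) ≠ s h + g (x + M + sortRank H s h) := by
    intro h hh
    by_cases h' : h = 0
    · rw [h']; exact hN0.ne
    · exact (hq h (Finset.mem_erase.2 ⟨h', hh⟩)).symm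
  refine hmain x M (c q) (fun j => x + M + sortRank H s j) hx ?_ ?_ (by omega) ?_ ?_ ?_ ?_
  · have key : ∀ i k, i < k → k < 2 * M + 2 → c q i ≠ c q k := by
      intro i k hik hk h
      rw [hcP q i (by omega)] at h
      by_cases hkN : k = 2 * M + 1
      · rw [hkN, hcN] at h
        unfold gapShiftSkip at h
        split_ifs at h <;> omega
      · rw [hcP q k (by omega)] at h
        have := hinj i (by omega) k (by omega) ((strictMono_gapShiftSkip _ _ _ _).injective h)
        omega
    intro i hi k hk h
    by_contra hne
    rcases lt_or_gt_of_ne hne with h' | h'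
    · exact key i k h' hk h
    · exact key k i h' hi h.symm
  · intro i hi
    by_cases hiN : i = 2 * M + 1
    · rw [hiN, hcN]; omega
    · rw [hcP q i (by omega)]
      have := hlt i (by omega)
      unfold gapShiftSkip
      split_ifs <;> omega
  · intro u hu w hw h
    exact injOn_sortRank H s hu hw (by simpa using h)
  · intro h hh
    have := sortRank_lt_card (s := s) hh
    omega
  · intro i hi
    rcases Nat.eq_zero_or_pos i with rfl | hpos
    · left
      rw [hcP q _ (by omega), hl0]; omega
    · obtain ⟨j, rfl⟩ : ∃ j, i = j + 1 := ⟨i - 1, by omega⟩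
      rw [hpred]
      rcases Nat.mod_two_eq_zero_or_one j with h | h
      · right
        have e1 := heven j (by omega) h
        have e2 := hTop _ e1 (hlt _ (by omega))
        rw [hcP q _ (by omega)]; omega
      · left
        have e1 := heven (j + 1) (by omega) (by omega)
        have e2 := hTop _ e1 (hlt _ (by omega))
        rw [hcP q _ (by omega)]; omega
  · have hin : ∀ j, j ∈ H → g (c q j) + g (c q (cyclePred (2 * M + 2) j)) +
        (if j ∈ H then ext j + g (x + M + sortRank H s j) else 0) =
        s j + g (x + M + sortRank H s j) := by
      intro j hj
      rw [if_pos hj]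
      simp only [hs, hv]
      ring
    have hout : ∀ j, j ∉ H → g (c q j) + g (c q (cyclePred (2 * M + 2) j)) +
        (if j ∈ H then ext j + g (x + M + sortRank H s j) else 0) = v q j := by
      intro j hj
      rw [if_neg hj, add_zero]
    have hpos : ∀ j, j ∉ H → ∃ i, j = i + 1 := fun j hj =>
      Nat.exists_eq_succ_of_ne_zero fun h => hj (h ▸ h0)
    have hPH : ∀ j < 2 * M + 2, j ∉ H → ∀ h ∈ H, v q j ≠ s h + g (x + M + sortRank H s h) := by
      intro j hj hjH h hh
      by_cases hjN : j = 2 * M + 1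
      · rw [hjN]; exact hNH h hh
      · obtain ⟨i, rfl⟩ := hpos j hjH
        exact ((hTB i (by omega)).trans_lt (hHbig h hh)).ne
    have hPP : ∀ j k, j < k → k < 2 * M + 2 → j ∉ H → k ∉ H → v q j ≠ v q k := by
      intro j k hjk hk hjH hkH
      obtain ⟨i, rfl⟩ := hpos j hjH
      by_cases hkN : k = 2 * M + 1
      · rw [hkN]
        exact ((hTB i (by omega)).trans_lt hNbig).ne
      · obtain ⟨i', rfl⟩ := hpos k hkH
        rw [hvS, hvS, hcP q _ (by omega), hcP q _ (by omega), hcP q _ (by omega),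
          hcP q _ (by omega)]
        rw [hflip i (by omega), not_not] at hjH
        exact pathLabel_sum_ne (hg.mono.comp (strictMono_gapShiftSkip x H.card M q))
          (by omega) (by omega) hjH
    intro i hi k hk h
    simp only [] at h
    by_cases hiH : i ∈ H <;> by_cases hkH : k ∈ H
    · rw [hin i hiH, hin k hkH] at h
      exact injOn_add_sortRank hg.mono H s (x + M) hiH hkH h
    · rw [hin i hiH, hout k hkH] at h
      exact absurd h.symm (hPH k hk hkH i hiH)
    · rw [hout i hiH, hin k hkH] at h
      exact absurd h (hPH i hi hiH k hkH)
    · rw [hout i hiH, hout k hkH] at h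
      by_contra hne
      rcases lt_or_gt_of_ne hne with h' | h'
      · exact hPP i k h' hk hiH hkH h
      · exact hPP k i h' hi hkH hiH h.symm

theorem Nat.mod_eq_ite_of_lt_two_mul {n a : ℕ} (h : a < 2 * n) :
    a % n = if a < n then a else a - n := by
  split_ifs with h'
  · exact Nat.mod_eq_of_lt h'
  · rw [Nat.mod_eq_sub_mod (not_lt.1 h')]
    exact Nat.mod_eq_of_lt (by omega)

theorem mem_image_rotate_iff {n s j : ℕ} {X : Type*} [Fintype X] {own : X → ℕ}
    (hown : ∀ x, own x < n) (hs : s < n) (hj : j < n) :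
    j ∈ Finset.univ.image (fun x => (own x + (n - s)) % n) ↔
      (s + j) % n ∈ Finset.univ.image own := by
  simp only [Finset.mem_image, Finset.mem_univ, true_and]
  refine exists_congr fun x => ?_
  have := hown x
  rw [Nat.mod_eq_ite_of_lt_two_mul (show own x + (n - s) < 2 * n by omega),
    Nat.mod_eq_ite_of_lt_two_mul (show s + j < 2 * n by omega)]
  split_ifs <;> omega

/-- Every leafy cycle has a labeling, after a suitable rotation of the cycle. -/
theorem exists_rotate_hasLeafyLabeling {g : ℕ → ℝ} (hg : Admissible g) {n : ℕ} (hn : 3 ≤ n)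
    {X : Type*} [Fintype X] (own : X → ℕ) (hown : ∀ x, own x < n) :
    ∃ s < n, HasLeafyLabeling g n (fun x => (own x + (n - s)) % n) := by
  rcases isEmpty_or_nonempty X with hX | hX
  · exact ⟨0, by omega, hasLeafyLabeling_of_isEmpty hg hn _⟩
  set H : Finset ℕ := Finset.univ.image own with hH
  have hHn : ∀ h ∈ H, h < n := by
    intro h hh
    simp only [hH, Finset.mem_image, Finset.mem_univ, true_and] at hh
    obtain ⟨x, rfl⟩ := hh
    exact hown x
  obtain ⟨h₀, hh₀⟩ : H.Nonempty := Finset.univ_nonempty.image own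
  have hlt : ∀ (s : ℕ) x, (own x + (n - s)) % n < n := fun s x => Nat.mod_lt _ (by omega)
  have hshift : ∀ a b, ((a % n) + b) % n = (a + b) % n := fun a b => Nat.mod_add_mod a n b
  have hwalk : ∃ s < n, (s + 0) % n ∈ H ∧ ∃ md : ℕ → Bool, md 0 = true ∧
      (∀ j, (s + (j + 1)) % n ∈ H ↔ md (j + 1) ≠ md j) ∧
      ∀ i, i ≤ 2 * ((Finset.range i).filter fun j => md j = true).card := by
    obtain ⟨m, -, hm, md, h0, hF, hmaj⟩ := exists_majority_start n (by omega)
      (fun k => (h₀ + k) % n ∈ H) (by simpa [Nat.mod_eq_of_lt (hHn _ hh₀)] using hh₀)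
      (fun k => by simp only [← add_assoc, Nat.add_mod_right])
    refine ⟨(h₀ + m) % n, Nat.mod_lt _ (by omega), ?_, md, h0, fun j => ?_, hmaj⟩
    · simpa using hm
    · rw [hshift, add_assoc]; exact hF j
  rcases Nat.even_or_odd' n with ⟨K, hK | hK⟩
  · obtain ⟨M, rfl⟩ : ∃ M, K = M + 1 := ⟨K - 1, by omega⟩
    by_cases hcard : H.card ≤ 2
    · suffices hs : ∃ s ∈ H, ∀ z ∈ H, z = s ∨ M + 1 ≤ (z + (n - s)) % n by
        obtain ⟨s, hsH, hz⟩ := hs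
        have hsn := hHn s hsH
        refine ⟨s, hsn, ?_⟩
        have := hlt s
        subst hK
        refine hasLeafyLabeling_even_of_card_le_two hg (by omega) _ _ rfl this ?_ ?_
        · rw [mem_image_rotate_iff hown hsn (by omega)]
          rwa [add_zero, Nat.mod_eq_of_lt hsn]
        · intro h hh
          simp only [Finset.mem_image, Finset.mem_univ, true_and] at hh
          obtain ⟨x, rfl⟩ := hh
          rcases hz (own x) (by simp [hH]) with h' | h'
          · left
            rw [h', Nat.add_sub_cancel' hsn.le, Nat.mod_self]
          · exact Or.inr h'
      by_cases hone : ∃ k ∈ H, k ≠ h₀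
      · obtain ⟨k, hk, hne⟩ := hone
        have hall : ∀ z ∈ H, z = h₀ ∨ z = k := by
          intro z hz
          by_contra hcon
          push Not at hcon
          have : 2 < H.card :=
            Finset.two_lt_card.2 ⟨h₀, hh₀, k, hk, z, hz, hne.symm, hcon.1.symm, hcon.2.symm⟩
          omega
        have h1 := hHn _ hh₀
        have h2 := hHn _ hk
        have e1 := Nat.mod_eq_ite_of_lt_two_mul (show k + (n - h₀) < 2 * n by omega)
        have e2 := Nat.mod_eq_ite_of_lt_two_mul (show h₀ + (n - k) < 2 * n by omega)
        by_cases hfar : M + 1 ≤ (k + (n - h₀)) % n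
        · refine ⟨h₀, hh₀, fun z hz => ?_⟩
          rcases hall z hz with rfl | rfl
          · exact Or.inl rfl
          · exact Or.inr hfar
        · refine ⟨k, hk, fun z hz => ?_⟩
          rcases hall z hz with rfl | rfl
          · right
            rw [e2]
            rw [e1] at hfar
            split_ifs at hfar ⊢ <;> omega
          · exact Or.inl rfl
      · push Not at hone
        exact ⟨h₀, hh₀, fun z hz => Or.inl (hone z hz)⟩
    · by_cases hadj : ∃ h ∈ H, (h + 1) % n ∈ H
      · obtain ⟨h, hh, hh'⟩ := hadj
        have hhn := hHn _ hh
        have hlast : (h + 1 + (2 * M + 1)) % n ∈ H := by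
          have e : h + 1 + (2 * M + 1) = h + n := by omega
          rwa [e, Nat.add_mod_right, Nat.mod_eq_of_lt hhn]
        obtain ⟨m, hmN, hm, md, h0, hF, hmaj⟩ := exists_majority_start (2 * M + 1) (by omega)
          (fun k => (h + 1 + k % (2 * M + 1)) % n ∈ H) (by simpa using hh')
          (fun k => by simp only [Nat.add_mod_right])
        have hsn : (h + 1 + m) % n < n := Nat.mod_lt _ (by omega)
        refine ⟨(h + 1 + m) % n, hsn, ?_⟩
        have hlt' := hlt ((h + 1 + m) % n)
        have hmem : ∀ j < n, (j ∈ Finset.univ.image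
            (fun x => (own x + (n - (h + 1 + m) % n)) % n) ↔ (h + 1 + m + j) % n ∈ H) := by
          intro j hj
          rw [mem_image_rotate_iff hown hsn hj, hshift]
        have hn2 : n = 2 * M + 2 := by omega
        clear hK
        subst hn2
        refine hasLeafyLabeling_even_of_adjacent hg (by omega) _ _ rfl hlt' ?_
          (w := 2 * M + 1 - m) (by omega) (by omega) ?_ ?_ md ?_ hmaj
        · rw [hmem _ (by omega)]
          rw [Nat.mod_eq_of_lt hmN] at hm
          simpa using hm
        · rw [hmem _ (by omega)]
          have e : h + 1 + m + (2 * M + 1 - m) = h + 1 + (2 * M + 1) := by omega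
          rwa [e]
        · intro hw
          rw [hmem _ (by omega)]
          have e : h + 1 + m + (2 * M + 1 - m + 1) = h + 1 + (2 * M + 2) := by omega
          rwa [e, Nat.add_mod_right]
        · intro j hj
          have hj' := hF j
          rw [Nat.mod_eq_ite_of_lt_two_mul (show m + (j + 1) < 2 * (2 * M + 1) by omega)] at hj'
          rw [← hj']
          by_cases hjw : j + 1 < 2 * M + 1 - m
          · rw [if_pos hjw, if_pos (by omega), hmem _ (by omega), add_assoc (h + 1)]
          · rw [if_neg hjw, if_neg (by omega), hmem _ (by omega)]
            have e : h + 1 + m + (j + 2) = h + 1 + (m + (j + 1) - (2 * M + 1)) + (2 * M + 2) := by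
              omega
            rw [e, Nat.add_mod_right]
      · push Not at hadj
        obtain ⟨s, hsn, hs0, md, h0, hF, hmaj⟩ := hwalk
        refine ⟨s, hsn, ?_⟩
        have hlt' := hlt s
        have hmem : ∀ j < n, (j ∈ Finset.univ.image
            (fun x => (own x + (n - s)) % n) ↔ (s + j) % n ∈ H) :=
          fun j hj => mem_image_rotate_iff hown hsn hj
        have hcard' : (Finset.univ.image (fun x => (own x + (n - s)) % n)).card = H.card := by
          have : Finset.univ.image (fun x => (own x + (n - s)) % n) =
              H.image (fun h => (h + (n - s)) % n) := by
            rw [hH, Finset.image_image]; rfl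
          rw [this]
          refine Finset.card_image_of_injOn ?_
          intro a ha b hb hab
          have ha' := hHn _ ha
          have hb' := hHn _ hb
          simp only at hab
          rw [Nat.mod_eq_ite_of_lt_two_mul (show a + (n - s) < 2 * n by omega),
            Nat.mod_eq_ite_of_lt_two_mul (show b + (n - s) < 2 * n by omega)] at hab
          split_ifs at hab <;> omega
        have hadj' : ∀ j, (s + j) % n ∈ H → (s + (j + 1)) % n ∉ H := by
          intro j hj
          have := hadj _ hj
          rwa [hshift] at this
        have hn2 : n = 2 * M + 2 := by omega
        clear hK
        subst hn2
        refine hasLeafyLabeling_even_of_not_adjacent hg (by omega) _ _ rfl hlt' ?_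
          (by omega) ?_ ?_ md h0 ?_ hmaj
        · rwa [hmem _ (by omega)]
        · intro j hj hj'
          have hjn : j + 1 < 2 * M + 2 := by
            rw [Finset.mem_image] at hj
            obtain ⟨x, -, hx⟩ := hj
            have := hlt' x
            omega
          rw [hmem _ hjn] at hj
          rw [hmem _ (by omega)] at hj'
          exact hadj' _ hj' hj
        · rw [hmem _ (by omega)]
          intro hj
          have := hadj' _ hj
          rw [show s + (2 * M + 1 + 1) = s + 0 + (2 * M + 2) by omega, Nat.add_mod_right] at this
          exact this hs0
        · intro j hj
          rw [hmem _ hj]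
          exact hF j
  · obtain ⟨s, hsn, hs0, md, h0, hF, hmaj⟩ := hwalk
    refine ⟨s, hsn, ?_⟩
    have hlt' := hlt s
    have hmem : ∀ j < n, (j ∈ Finset.univ.image
        (fun x => (own x + (n - s)) % n) ↔ (s + j) % n ∈ H) :=
      fun j hj => mem_image_rotate_iff hown hsn hj
    subst hK
    refine hasLeafyLabeling_odd hg (by omega) _ _ rfl hlt' ?_ md ?_ hmaj
    · rwa [hmem _ (by omega)]
    · intro j hj
      rw [hmem _ hj]
      exact hF j

/-- The successor on the cycle with vertices `0, …, n - 1`. -/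
def cycleSucc {n : ℕ} (i : Fin n) : Fin n :=
  ⟨if i.val + 1 = n then 0 else i.val + 1, by split_ifs <;> omega⟩

/-- A labeling of the combinatorial model of a leafy cycle gives a labeling of the graph. -/
theorem exists_edge_index {V : Type*} [Fintype V] {G : SimpleGraph V} {g : ℕ → ℝ}
    (hg : StrictMono g) {n : ℕ} (hn : 3 ≤ n) (w : Fin n → V) (hw : Function.Injective w)
    {X : Type*} [Fintype X] (leaf : X → V) (hleafinj : Function.Injective leaf)
    (hxw : ∀ x i, leaf x ≠ w i) (hcover : ∀ v, (∃ i, w i = v) ∨ ∃ x, leaf x = v)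
    (own : X → ℕ) (hown : ∀ x, own x < n)
    (hcycle : ∀ i j, G.Adj (w i) (w j) ↔ cycleSucc i = j ∨ cycleSucc j = i)
    (hleaf : ∀ x y, G.Adj (leaf x) y ↔ y = w ⟨own x, hown x⟩)
    (hlab : HasLeafyLabeling g n own) :
    ∃ idx : Sym2 V → ℕ, Set.BijOn idx (edgeFS G) (Finset.range (edgeFS G).card) ∧
      Function.Injective (vSum G (fun e => g (idx e))) := by
  obtain ⟨c, L, hc, hL, hcL, hcn, hLn, hinj, hne⟩ := hlab
  set E : Fin n ⊕ X → Sym2 V :=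
    Sum.elim (fun i => s(w i, w (cycleSucc i))) (fun x => s(leaf x, w ⟨own x, hown x⟩)) with hE
  set lab : Fin n ⊕ X → ℕ := Sum.elim (fun i => c i) L with hlab
  have hEinj : Function.Injective E := by
    rintro (i | x) (j | y) h
    · simp only [hE, Sum.elim_inl, Sym2.eq_iff, hw.eq_iff, Fin.ext_iff, cycleSucc] at h
      congr 1
      ext
      split_ifs at h <;> omega
    · simp only [hE, Sum.elim_inl, Sum.elim_inr, Sym2.eq_iff] at h
      rcases h with ⟨h, -⟩ | ⟨-, h⟩
      · exact absurd h.symm (hxw _ _)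
      · exact absurd h.symm (hxw _ _)
    · simp only [hE, Sum.elim_inl, Sum.elim_inr, Sym2.eq_iff] at h
      rcases h with ⟨h, -⟩ | ⟨h, -⟩
      · exact absurd h (hxw _ _)
      · exact absurd h (hxw _ _)
    · simp only [hE, Sum.elim_inr, Sym2.eq_iff] at h
      rcases h with ⟨h, -⟩ | ⟨h, -⟩
      · exact congrArg _ (hleafinj h)
      · exact absurd h (hxw _ _)
  have hedge : edgeFS G = Finset.univ.image E := by
    ext e
    simp only [edgeFS, Set.mem_toFinset, Finset.mem_image, Finset.mem_univ, true_and, Sum.exists]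
    constructor
    · induction e using Sym2.ind with
      | _ u v =>
        intro h
        rw [SimpleGraph.mem_edgeSet] at h
        rcases hcover u with ⟨i, rfl⟩ | ⟨x, rfl⟩
        · rcases hcover v with ⟨j, rfl⟩ | ⟨x, rfl⟩
          · rcases (hcycle i j).1 h with rfl | rfl
            · exact Or.inl ⟨i, rfl⟩
            · exact Or.inl ⟨j, Sym2.eq_swap⟩
          · rw [(hleaf x _).1 h.symm]
            exact Or.inr ⟨x, Sym2.eq_swap⟩
        · rw [(hleaf x v).1 h]
          exact Or.inr ⟨x, rfl⟩
    · rintro (⟨i, rfl⟩ | ⟨x, rfl⟩)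
      · exact (hcycle _ _).2 (Or.inl rfl)
      · exact (hleaf _ _).2 rfl
  have hcard : (edgeFS G).card = n + Fintype.card X := by
    rw [hedge, Finset.card_image_of_injective _ hEinj, Finset.card_univ, Fintype.card_sum,
      Fintype.card_fin]
  have hlabinj : Function.Injective lab := by
    rintro (i | x) (j | y) h
    · exact congrArg _ (Fin.ext (hc i.2 j.2 h))
    · exact absurd h (hcL i i.2 y)
    · exact absurd h.symm (hcL j j.2 x)
    · exact congrArg _ (hL h)
  have hlablt : ∀ t, lab t < n + Fintype.card X := by
    rintro (i | x)
    · exact hcn i i.2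
    · exact hLn x
  have hidx : ∀ t, Function.extend E lab 0 (E t) = lab t := fun t => hEinj.extend_apply _ _ _
  have hsum : ∀ v, vSum G (fun e => g (Function.extend E lab 0 e)) v =
      (∑ i : Fin n, if v ∈ E (Sum.inl i) then g (c i) else 0) +
        ∑ x : X, if v ∈ E (Sum.inr x) then g (L x) else 0 := by
    intro v
    rw [vSum, hedge, Finset.filter_image, Finset.sum_image hEinj.injOn, Finset.sum_filter,
      Fintype.sum_sum_type]
    simp only [hidx]
    rfl
  have hvertex : ∀ j : Fin n, vSum G (fun e => g (Function.extend E lab 0 e)) (w j) =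
      g (c j) + g (c (cyclePred n j)) +
        ∑ x ∈ Finset.univ.filter (fun x => own x = j), g (L x) := by
    intro j
    rw [hsum]
    congr 1
    · have hmem : ∀ i : Fin n, w j ∈ E (Sum.inl i) ↔
          i ∈ ({j, ⟨cyclePred n j, cyclePred_lt j.2⟩} : Finset (Fin n)) := by
        intro i
        simp only [hE, Sum.elim_inl, Sym2.mem_iff, hw.eq_iff, Finset.mem_insert,
          Finset.mem_singleton, Fin.ext_iff, cycleSucc, cyclePred]
        split_ifs <;> omega
      simp only [hmem]
      rw [Finset.sum_ite_mem, Finset.univ_inter, Finset.sum_pair]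
      simp only [ne_eq, Fin.ext_iff, cyclePred]
      split_ifs <;> omega
    · rw [Finset.sum_filter]
      refine Finset.sum_congr rfl fun x _ => ?_
      refine if_congr ?_ rfl rfl
      simp only [hE, Sum.elim_inr, Sym2.mem_iff, hw.eq_iff, (hxw x j).symm, false_or,
        Fin.ext_iff, eq_comm]
  have hpendant : ∀ x : X, vSum G (fun e => g (Function.extend E lab 0 e)) (leaf x) = g (L x) := by
    intro x
    rw [hsum]
    have h1 : ∀ i : Fin n, leaf x ∉ E (Sum.inl i) := by
      intro i
      simp [hE, Sym2.mem_iff, hxw]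
    have h2 : ∀ y : X, leaf x ∈ E (Sum.inr y) ↔ y = x := by
      intro y
      simp [hE, Sym2.mem_iff, hxw, hleafinj.eq_iff, eq_comm]
    simp only [h1, h2, if_false, Finset.sum_const_zero, zero_add, Finset.sum_ite_eq',
      Finset.mem_univ, if_true]
  refine ⟨Function.extend E lab 0, ?_, ?_⟩
  · have hinjOn : Set.InjOn (Function.extend E lab 0) (edgeFS G) := by
      rw [hedge]
      intro e he e' he' h
      simp only [Finset.coe_image, Finset.coe_univ, Set.image_univ, Set.mem_range] at he he'
      obtain ⟨t, rfl⟩ := he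
      obtain ⟨t', rfl⟩ := he'
      rw [hidx, hidx] at h
      rw [hlabinj h]
    have himage : (edgeFS G).image (Function.extend E lab 0) = Finset.range (edgeFS G).card := by
      refine Finset.eq_of_subset_of_card_le ?_ ?_
      · rw [hcard, hedge]
        intro k hk
        simp only [Finset.mem_image, Finset.mem_univ, true_and, exists_exists_eq_and] at hk
        obtain ⟨t, rfl⟩ := hk
        rw [hidx, Finset.mem_range]
        exact hlablt t
      · rw [Finset.card_image_of_injOn hinjOn, Finset.card_range]
    rw [← himage, Finset.coe_image]
    exact hinjOn.bijOn_image
  · intro u v huv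
    rcases hcover u with ⟨i, rfl⟩ | ⟨x, rfl⟩ <;> rcases hcover v with ⟨j, rfl⟩ | ⟨y, rfl⟩
    · rw [hvertex, hvertex] at huv
      exact congrArg w (Fin.ext (hinj i.2 j.2 huv))
    · rw [hvertex, hpendant] at huv
      exact absurd huv (hne i i.2 _)
    · rw [hvertex, hpendant] at huv
      exact absurd huv.symm (hne j j.2 _)
    · rw [hpendant, hpendant] at huv
      exact congrArg leaf (hL (hg.injective huv))

theorem cycleGraph_adj_iff_mod {n : ℕ} (hn : 3 ≤ n) (u v : Fin n) :
    (SimpleGraph.cycleGraph n).Adj u v ↔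
      (u.val + 1) % n = v.val ∨ (v.val + 1) % n = u.val := by
  rw [SimpleGraph.cycleGraph_adj', Fin.val_sub, Fin.val_sub]
  have hu := u.2
  have hv := v.2
  rw [Nat.mod_eq_ite_of_lt_two_mul (show n - v.val + u.val < 2 * n by omega),
    Nat.mod_eq_ite_of_lt_two_mul (show n - u.val + v.val < 2 * n by omega),
    Nat.mod_eq_ite_of_lt_two_mul (show u.val + 1 < 2 * n by omega),
    Nat.mod_eq_ite_of_lt_two_mul (show v.val + 1 < 2 * n by omega)]
  split_ifs <;> omega

theorem IsLeafyGraphOf.exists_edge_index {V : Type*} [Fintype V] {n : ℕ} (hn : 3 ≤ n)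
    {G : SimpleGraph V} (hG : IsLeafyGraphOf G (SimpleGraph.cycleGraph n)) {g : ℕ → ℝ}
    (hg : Admissible g) :
    ∃ idx : Sym2 V → ℕ, Set.BijOn idx (edgeFS G) (Finset.range (edgeFS G).card) ∧
      Function.Injective (vSum G (fun e => g (idx e))) := by
  obtain ⟨f, hf, hleaf⟩ := hG
  have hnbr : ∀ x : {x // x ∉ Set.range f}, ∃ v : Fin n, ∀ y, G.Adj x y ↔ y = f v := by
    rintro ⟨x, hx⟩
    obtain ⟨hdeg, v, hv, -⟩ := hleaf x hx
    obtain ⟨z, -, hz⟩ := SimpleGraph.degree_eq_one_iff_existsUnique_adj.1 hdeg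
    refine ⟨v, fun y => ⟨fun h => (hz y h).trans (hz _ hv).symm, ?_⟩⟩
    rintro rfl
    exact hv
  choose nbr hnbr using hnbr
  obtain ⟨s, hs, hlab⟩ := exists_rotate_hasLeafyLabeling hg hn (fun x => (nbr x).val)
    (fun x => (nbr x).2)
  have hmod : ∀ k, k % n < n := fun k => Nat.mod_lt _ (by omega)
  set rot : Fin n → Fin n := fun j => ⟨(s + j.val) % n, hmod _⟩ with hrot
  have hrotval : ∀ j, (rot j).val = if s + j.val < n then s + j.val else s + j.val - n :=
    fun j => Nat.mod_eq_ite_of_lt_two_mul (by omega)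
  have hrotinj : Function.Injective rot := by
    intro i j h
    have h' := congrArg Fin.val h
    rw [hrotval, hrotval] at h'
    ext
    split_ifs at h' <;> omega
  have hrotsurj : Function.Surjective rot := Finite.surjective_of_injective hrotinj
  refine _root_.exists_edge_index hg.mono hn (fun j => f (rot j)) (f.injective.comp hrotinj)
    (Subtype.val : {x // x ∉ Set.range f} → V) Subtype.val_injective
    (fun x i h => x.2 ⟨_, h.symm⟩) ?_ _ (fun x => hmod _) ?_ ?_ hlab
  · intro v
    by_cases hv : v ∈ Set.range f
    · obtain ⟨u, rfl⟩ := hv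
      obtain ⟨i, rfl⟩ := hrotsurj u
      exact Or.inl ⟨i, rfl⟩
    · exact Or.inr ⟨⟨v, hv⟩, rfl⟩
  · intro i j
    rw [hf, cycleGraph_adj_iff_mod hn,
      Nat.mod_eq_ite_of_lt_two_mul (show (rot i).val + 1 < 2 * n by omega),
      Nat.mod_eq_ite_of_lt_two_mul (show (rot j).val + 1 < 2 * n by omega), hrotval, hrotval]
    simp only [cycleSucc, Fin.ext_iff]
    split_ifs <;> omega
  · intro x y
    rw [hnbr]
    have : rot ⟨((nbr x).val + (n - s)) % n, hmod _⟩ = nbr x := by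
      ext
      rw [hrotval]
      have := Nat.mod_eq_ite_of_lt_two_mul (show (nbr x).val + (n - s) < 2 * n by omega)
      simp only [this]
      split_ifs <;> omega
    rw [this]

theorem IsLeafyGraphOf.arithAntimagic {V : Type*} [Fintype V] {n : ℕ} (hn : 3 ≤ n)
    {G : SimpleGraph V} (hG : IsLeafyGraphOf G (SimpleGraph.cycleGraph n)) :
    ArithAntimagic G := by
  intro a d ha hd
  have hadm := admissible_linear ha hd
  obtain ⟨idx, hbij, hinj⟩ := hG.exists_edge_index hn hadm
  refine ⟨fun e => a + (idx e : ℝ) * d, ?_, hinj⟩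
  rw [Finset.coe_image]
  exact (hadm.mono.injective.injOn.bijOn_image).comp hbij

theorem IsLeafyGraphOf.arithProdAntimagic {V : Type*} [Fintype V] {n : ℕ} (hn : 3 ≤ n)
    {G : SimpleGraph V} (hG : IsLeafyGraphOf G (SimpleGraph.cycleGraph n)) :
    ArithProdAntimagic G := by
  intro a d ha hd
  obtain ⟨idx, hbij, hinj⟩ := hG.exists_edge_index hn (admissible_log ha hd)
  refine ⟨fun e => a + (idx e : ℝ) * d, ?_, ?_⟩
  · rw [Finset.coe_image]
    exact ((admissible_linear (by linarith) hd).mono.injective.injOn.bijOn_image).comp hbij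
  · intro u v huv
    have hlog : ∀ v, vSum G (fun e => Real.log (a + (idx e : ℝ) * d)) v =
        Real.log (vProd G (fun e => a + (idx e : ℝ) * d) v) := by
      intro v
      rw [vSum, vProd, Real.log_prod]
      intro e _
      positivity
    apply hinj
    simp only [hlog, huv]

/-- Every leafy graph of a cycle is arithmetic antimagic and arithmetic
product antimagic. -/
theorem stmt_15 {V' : Type*} [Fintype V'] (n : ℕ) (hn : 3 ≤ n) (G' : SimpleGraph V')
    (hleafy : IsLeafyGraphOf G' (SimpleGraph.cycleGraph n)) :
    ArithAntimagic G' ∧ ArithProdAntimagic G' := by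
  exact ⟨hleafy.arithAntimagic hn, hleafy.arithProdAntimagic hn⟩
end

section
/- Every caterpillar with at least three edges is arithmetic antimagic. -/
open scoped Classical

/-- A caterpillar: a tree in which removing all vertices of degree one yields a path
(possibly empty). -/
def IsCaterpillar {V : Type*} [Fintype V] (T : SimpleGraph V) : Prop :=
  T.IsTree ∧ ∃ k : ℕ,
    Nonempty ((SimpleGraph.induce {v : V | T.degree v ≠ 1} T) ≃g SimpleGraph.pathGraph k)

/-- The sequence `N` solving `N j = F j N`, when `F j` only looks at values below `j`. -/
noncomputable def courseOfValues (F : ℕ → (ℕ → ℕ) → ℕ) (j : ℕ) : ℕ :=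
  F j (fun i => if i < j then courseOfValues F i else 0)
termination_by j
decreasing_by assumption

theorem courseOfValues_eq (F : ℕ → (ℕ → ℕ) → ℕ)
    (hF : ∀ j f g, (∀ i < j, f i = g i) → F j f = F j g) (j : ℕ) :
    courseOfValues F j = F j (courseOfValues F) := by
  rw [courseOfValues]
  exact hF _ _ _ fun i hi => if_pos hi

/-- Labels along the path: even positions carry the arithmetic progression starting at `β`,
odd positions carry the terms of index `A 0, A 1, …` of the progression starting at `a`. -/
noncomputable def zigzag (a d β : ℝ) (A : ℕ → ℕ) (i : ℕ) : ℝ :=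
  if i % 2 = 0 then β + (i / 2 : ℕ) * d else a + A (i / 2) * d

theorem zigzag_even (a d β : ℝ) (A : ℕ → ℕ) (j : ℕ) :
    zigzag a d β A (2 * j) = β + j * d := by
  simp [zigzag]

theorem zigzag_odd (a d β : ℝ) (A : ℕ → ℕ) (j : ℕ) :
    zigzag a d β A (2 * j + 1) = a + A j * d := by
  have h1 : (2 * j + 1) % 2 = 1 := by omega
  have h2 : (2 * j + 1) / 2 = j := by omega
  simp [zigzag, h1, h2]

theorem le_zigzag_add_succ {a d β : ℝ} (hd : 0 < d) {A : ℕ → ℕ}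
    (hA : ∀ j, j ≤ A j) {i j : ℕ} (hij : 2 * j ≤ i) :
    β + j * d + a + j * d ≤ zigzag a d β A i + zigzag a d β A (i + 1) := by
  obtain ⟨n, rfl | rfl⟩ := i.even_or_odd'
  · have h1 : (j : ℝ) ≤ n := by exact_mod_cast (by omega : j ≤ n)
    have h2 : (j : ℝ) ≤ A n := by exact_mod_cast (by have := hA n; omega : j ≤ A n)
    rw [zigzag_even, zigzag_odd]
    nlinarith
  · have h1 : (j : ℝ) ≤ n := by exact_mod_cast (by omega : j ≤ n)
    have h2 : (j : ℝ) ≤ A n := by exact_mod_cast (by have := hA n; omega : j ≤ A n)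
    rw [show 2 * n + 1 + 1 = 2 * (n + 1) by ring, zigzag_even, zigzag_odd]
    push_cast
    nlinarith

/-- A stable placement: the odd path positions `0, …, h` and the elements of `W` can be jointly
enumerated so that an element of `W` precedes the odd position `j` only if its partial sum is less
than `β + (j + 1) * d`, follows it only if the partial sum exceeds `β + j * d`, and the elements of
`W` are sorted by partial sums. -/
theorem exists_stable_placement (h : ℕ) (W : Finset ℕ) (X : ℕ → ℝ) (hX : ∀ w, 0 ≤ X w)
    {a d β : ℝ} (ha : 0 < a) (hd : 0 < d) :
    ∃ A C : ℕ → ℕ, StrictMono A ∧ Set.InjOn C W ∧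
      (∀ j ≤ h, ∀ w ∈ W, A j ≠ C w) ∧
      (∀ j ≤ h, A j < h + 1 + W.card) ∧ (∀ w ∈ W, C w < h + 1 + W.card) ∧
      (∀ j ≤ h, ∀ w ∈ W, C w < A j →
        zigzag a d β A w + zigzag a d β A (w + 1) + X w < β + j * d + d) ∧
      (∀ j ≤ h, ∀ w ∈ W, A j < C w →
        β + j * d < zigzag a d β A w + zigzag a d β A (w + 1) + X w) ∧
      (∀ w ∈ W, ∀ w' ∈ W, C w < C w' →
        zigzag a d β A w + zigzag a d β A (w + 1) + X w ≤
          zigzag a d β A w' + zigzag a d β A (w' + 1) + X w') := by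
  set F : ℕ → (ℕ → ℕ) → ℕ := fun j f => j + (W.filter fun w => w < 2 * j ∧
    zigzag a d β f w + zigzag a d β f (w + 1) + X w < β + j * d + d).card with hFdef
  have hF : ∀ j f g, (∀ i < j, f i = g i) → F j f = F j g := by
    intro j f g hfg
    have hz : ∀ i ≤ 2 * j, zigzag a d β f i = zigzag a d β g i := by
      intro i hi
      unfold zigzag
      split_ifs with h0
      · rfl
      · rw [hfg _ (by omega)]
    simp only [hFdef]
    congr 2
    refine Finset.filter_congr fun w _ => and_congr_right fun hw => ?_
    rw [hz w (by omega), hz (w + 1) (by omega)]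
  obtain ⟨A, hA⟩ : ∃ A, ∀ j, A j = F j A := ⟨_, courseOfValues_eq F hF⟩
  have hle : ∀ j, j ≤ A j := fun j => by rw [hA]; exact Nat.le_add_right _ _
  set p : ℕ → ℝ := fun w => zigzag a d β A w + zigzag a d β A (w + 1) + X w with hp
  have hpβ : ∀ w, β < p w := by
    intro w
    have := le_zigzag_add_succ (a := a) (β := β) hd hle (show 2 * 0 ≤ w by omega)
    have := hX w
    simp only [hp]
    push_cast at *
    linarith
  set κ : ℕ → ℝ := fun j => if j = 0 then β else β + j * d + d with hκ
  have hκmono : StrictMono κ := by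
    refine strictMono_nat_of_lt_succ fun n => ?_
    simp only [hκ]
    have : (0 : ℝ) ≤ n * d := by positivity
    rw [if_neg n.succ_ne_zero]
    push_cast
    split_ifs <;> linarith
  have hκle : ∀ j, κ j ≤ β + j * d + d := by
    intro j
    simp only [hκ]
    split_ifs with h0
    · subst h0; push_cast; linarith
    · exact le_rfl
  have hAκ : ∀ j, A j = j + (W.filter fun w => p w < κ j).card := by
    intro j
    rw [hA]
    simp only [hFdef]
    congr 2
    refine Finset.filter_congr fun w _ => ?_
    rcases Nat.eq_zero_or_pos j with rfl | hj
    · simpa [hκ] using (hpβ w).le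
    · have hj1 : (1 : ℝ) ≤ j := by exact_mod_cast hj
      rw [show κ j = β + j * d + d from if_neg hj.ne']
      refine ⟨fun h => h.2, fun h => ⟨?_, h⟩⟩
      by_contra! hw
      have := le_zigzag_add_succ (a := a) (β := β) hd hle hw
      have := hX w
      have : d ≤ j * d := by nlinarith
      simp only [hp] at h
      linarith
  set lt : ℕ → ℕ → Prop := fun v w => p v < p w ∨ p v = p w ∧ v < w with hlt
  set C : ℕ → ℕ := fun w => ((Finset.range (h + 1)).filter fun j => κ j ≤ p w).card +
    (W.filter fun v => lt v w).card with hC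
  have hCmono : ∀ v ∈ W, ∀ w ∈ W, lt v w → C v < C w := by
    intro v hv w hw hvw
    simp only [hC]
    refine add_lt_add_of_le_of_lt (Finset.card_le_card ?_) (Finset.card_lt_card ?_)
    · refine Finset.monotone_filter_right _ fun j _ hj => hj.trans ?_
      rcases hvw with h | h
      · exact h.le
      · exact h.1.le
    · refine (Finset.ssubset_iff_of_subset ?_).2 ⟨v, ?_, ?_⟩
      · refine Finset.monotone_filter_right _ fun u _ hu => ?_
        simp only [hlt] at *
        grind
      · simp [hv, hvw]
      · simp [hlt]
  have hAC : ∀ j ≤ h, ∀ w, κ j ≤ p w → A j < C w := by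
    intro j hj w hw
    rw [hAκ]
    simp only [hC]
    refine add_lt_add_of_lt_of_le ?_ (Finset.card_le_card ?_)
    · calc j < (Finset.range (j + 1)).card := by simp
        _ ≤ _ := Finset.card_le_card fun i hi => by
          rw [Finset.mem_range] at hi
          rw [Finset.mem_filter, Finset.mem_range]
          exact ⟨by omega, (hκmono.monotone (by omega)).trans hw⟩
    · exact Finset.monotone_filter_right _ fun u _ hu => Or.inl (hu.trans_le hw)
  have hCA : ∀ j ≤ h, ∀ w ∈ W, p w < κ j → C w < A j := by
    intro j hj w hwW hw
    rw [hAκ]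
    simp only [hC]
    refine add_lt_add_of_le_of_lt ?_ (Finset.card_lt_card ?_)
    · calc _ ≤ (Finset.range j).card := Finset.card_le_card fun i hi => by
            rw [Finset.mem_filter] at hi
            rw [Finset.mem_range]
            exact hκmono.lt_iff_lt.1 (hi.2.trans_lt hw)
        _ = j := by simp
    · refine (Finset.ssubset_iff_of_subset ?_).2 ⟨w, ?_, ?_⟩
      · refine Finset.monotone_filter_right _ fun u _ hu => ?_
        rcases hu with h | h
        · exact h.trans hw
        · exact h.1.trans_lt hw
      · simp [hwW, hw]
      · simp [hlt]
  refine ⟨A, C, ?_, ?_, ?_, ?_, ?_, ?_, ?_, ?_⟩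
  · refine strictMono_nat_of_lt_succ fun n => ?_
    rw [hAκ, hAκ]
    refine add_lt_add_of_lt_of_le (Nat.lt_succ_self n) (Finset.card_le_card ?_)
    exact Finset.monotone_filter_right _ fun u _ hu => hu.trans (hκmono (Nat.lt_succ_self n))
  · intro v hv w hw hvw
    by_contra hne
    have : lt v w ∨ lt w v := by
      simp only [hlt]
      rcases lt_trichotomy (p v) (p w) with h | h | h <;> rcases lt_or_gt_of_ne hne with h' | h' <;>
        simp [h, h']
    rcases this with h | h
    · exact (hCmono v hv w hw h).ne hvw
    · exact (hCmono w hw v hv h).ne' hvw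
  · intro j hj w hw
    rcases le_or_gt (κ j) (p w) with h | h
    · exact (hAC j hj w h).ne
    · exact (hCA j hj w hw h).ne'
  · intro j hj
    rw [hAκ]
    have := Finset.card_filter_le W fun w => p w < κ j
    omega
  · intro w hw
    simp only [hC]
    refine add_lt_add_of_le_of_lt ?_ (Finset.card_lt_card ?_)
    · simpa using Finset.card_filter_le (Finset.range (h + 1)) fun j => κ j ≤ p w
    · exact (Finset.ssubset_iff_of_subset (Finset.filter_subset _ _)).2 ⟨w, hw, by simp [hlt]⟩
  · intro j hj w hw hlt
    refine lt_of_lt_of_le ?_ (hκle j)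
    by_contra! hge
    exact (hAC j hj w hge).asymm hlt
  · intro j hj w hw hlt
    have hge : κ j ≤ p w := by
      by_contra! hl
      exact (hCA j hj w hw hl).asymm hlt
    rcases Nat.eq_zero_or_pos j with rfl | hj0
    · simpa using hpβ w
    · rw [show κ j = β + j * d + d from if_neg hj0.ne'] at hge
      exact lt_of_lt_of_le (by linarith) hge
  · intro v hv w hw hvw
    by_contra! hl
    exact (hCmono w hw v hv (Or.inl hl)).asymm hvw

theorem strictMono_zigzag_add_succ {a d β : ℝ} (hd : 0 < d) {A : ℕ → ℕ} (hA : StrictMono A) :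
    StrictMono fun i => zigzag a d β A i + zigzag a d β A (i + 1) := by
  refine strictMono_nat_of_lt_succ fun i => ?_
  obtain ⟨n, rfl | rfl⟩ := i.even_or_odd'
  · rw [show 2 * n + 1 + 1 = 2 * (n + 1) by ring, zigzag_even, zigzag_even]
    push_cast
    linarith
  · rw [show 2 * n + 1 + 1 + 1 = 2 * (n + 1) + 1 by ring, zigzag_odd, zigzag_odd]
    have : (A n : ℝ) < A (n + 1) := by exact_mod_cast hA (Nat.lt_succ_self n)
    nlinarith

/-- Distinctness of the vertex sums along the path: vertex `u` receives the two path labels, the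
fixed amount `X u`, and the label of index `C u` if it lies in `W`. -/
theorem exists_injective_placement (h : ℕ) (W : Finset ℕ) (X : ℕ → ℝ) (hX : ∀ w, 0 ≤ X w)
    (hXW : ∀ w ∉ W, X w = 0) {a d β : ℝ} (ha : 0 < a) (hd : 0 < d) :
    ∃ A C : ℕ → ℕ, StrictMono A ∧ Set.InjOn C W ∧
      (∀ j ≤ h, ∀ w ∈ W, A j ≠ C w) ∧
      (∀ j ≤ h, A j < h + 1 + W.card) ∧ (∀ w ∈ W, C w < h + 1 + W.card) ∧
      ∀ u ≤ 2 * h, ∀ v ≤ 2 * h,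
        zigzag a d β A u + zigzag a d β A (u + 1) + X u + (if u ∈ W then a + C u * d else 0) =
          zigzag a d β A v + zigzag a d β A (v + 1) + X v + (if v ∈ W then a + C v * d else 0) →
        u = v := by
  obtain ⟨A, C, hA, hC, hAC, hAlt, hClt, h1, h2, h3⟩ :=
    exists_stable_placement h W X hX (β := β) ha hd
  refine ⟨A, C, hA, hC, hAC, hAlt, hClt, ?_⟩
  have hmono := strictMono_zigzag_add_succ (a := a) (β := β) hd hA
  have hcast : ∀ {m n : ℕ}, m < n → (m : ℝ) * d + d ≤ n * d := by
    intro m n hmn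
    have : (m : ℝ) + 1 ≤ n := by exact_mod_cast hmn
    nlinarith
  have key : ∀ u ≤ 2 * h, ∀ v ∈ W, zigzag a d β A u + zigzag a d β A (u + 1) ≠
      zigzag a d β A v + zigzag a d β A (v + 1) + X v + (a + C v * d) := by
    intro u hu v hv
    have hl := hmono.monotone (show 2 * (u / 2) ≤ u by omega)
    have hr := hmono.monotone (show u ≤ 2 * (u / 2) + 1 by omega)
    simp only [zigzag_even, zigzag_odd, show 2 * (u / 2) + 1 + 1 = 2 * (u / 2 + 1) by ring]
      at hl hr
    push_cast at hr
    rcases lt_or_gt_of_ne (hAC (u / 2) (by omega) v hv) with hlt | hlt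
    · have := h2 _ (by omega) v hv hlt
      have := hcast hlt
      intro h
      linarith
    · have := h1 _ (by omega) v hv hlt
      have := hcast hlt
      intro h
      linarith
  intro u hu v hv huv
  by_cases huW : u ∈ W <;> by_cases hvW : v ∈ W
  · rw [if_pos huW, if_pos hvW] at huv
    by_contra hne
    rcases lt_or_gt_of_ne (fun h => hne (hC huW hvW h)) with hlt | hlt
    · have := h3 u huW v hvW hlt
      have := hcast hlt
      linarith
    · have := h3 v hvW u huW hlt
      have := hcast hlt
      linarith
  · rw [if_pos huW, if_neg hvW, hXW v hvW, add_zero, add_zero] at huv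
    exact absurd huv.symm (key v hv u huW)
  · rw [if_neg huW, if_pos hvW, hXW u huW, add_zero, add_zero] at huv
    exact absurd huv (key u hu v hvW)
  · rw [if_neg huW, if_neg hvW, hXW u huW, hXW v hvW] at huv
    simp only [add_zero] at huv
    exact hmono.injective huv

/-- The arithmetic form of the result: a path with edges `0, …, k` and inner vertices
`0, …, k - 1`, where vertex `i` lies on the edges `i` and `i + 1` and on the pendant edges `x`
with `own x = i`. -/
theorem exists_labels {M : Type*} [Fintype M] {k : ℕ} (hk : 1 ≤ k) (own : M → ℕ)
    {a d : ℝ} (ha : 0 < a) (hd : 0 < d) :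
    ∃ (c : ℕ → ℕ) (g : M → ℕ) (S : ℕ → ℝ),
      (∀ i ≤ k, ∀ j ≤ k, c i = c j → i = j) ∧ Function.Injective g ∧
      (∀ i ≤ k, ∀ x, c i ≠ g x) ∧
      (∀ i ≤ k, c i < k + 1 + Fintype.card M) ∧ (∀ x, g x < k + 1 + Fintype.card M) ∧
      (∀ i, S i = (a + c i * d) + (a + c (i + 1) * d) +
        ∑ x ∈ Finset.univ.filter (fun x => own x = i), (a + g x * d)) ∧
      (∀ i < k, ∀ j < k, S i = S j → i = j) ∧
      (∀ i < k, ∀ x, S i ≠ a + g x * d) ∧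
      (∀ i < k, S i ≠ a + c 0 * d) ∧ (∀ i < k, S i ≠ a + c k * d) := by
  obtain ⟨h, o, ho, hkh⟩ : ∃ h o : ℕ, o ≤ 1 ∧ k + o = 2 * h + 1 :=
    ⟨k / 2, 1 - k % 2, by omega, by omega⟩
  obtain ⟨rep, hrep, hrep'⟩ : ∃ rep : M → M, (∀ x, own (rep x) = own x) ∧
      ∀ x y, own x = own y → rep x = rep y := by
    have h : ∀ x, ∃ y, own y = own x := fun x => ⟨x, rfl⟩
    refine ⟨fun x => (h x).choose, fun x => (h x).choose_spec, fun x y hxy => ?_⟩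
    simp only [hxy]
  set Ex : Finset M := Finset.univ.filter fun x => rep x ≠ x with hEx
  set Sp : Finset M := Finset.univ.filter fun x => rep x = x with hSp
  set W : Finset ℕ := Finset.univ.image fun x => own x + o with hW
  have hWcard : Sp.card = W.card := by
    refine Finset.card_bij (fun x _ => own x + o) (fun x _ => ?_) (fun x hx y hy hxy => ?_) ?_
    · exact Finset.mem_image_of_mem _ (Finset.mem_univ _)
    · have := hrep' x y (by omega)
      simp only [hSp, Finset.mem_filter] at hx hy
      rw [← hx.2, ← hy.2, this]
    · intro w hw
      obtain ⟨x, -, rfl⟩ := Finset.mem_image.1 hw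
      exact ⟨rep x, by simp [hSp, hrep' _ _ (hrep x)], by rw [hrep]⟩
  have hcard : Fintype.card M = Ex.card + W.card := by
    rw [← hWcard, add_comm]
    exact (Finset.card_filter_add_card_filter_not _).symm
  obtain ⟨idx, hidx, hidxlt⟩ : ∃ idx : M → ℕ, Set.InjOn idx Ex ∧ ∀ x ∈ Ex, idx x < Ex.card := by
    refine ⟨fun x => if hx : x ∈ Ex then Ex.equivFin ⟨x, hx⟩ else 0, ?_, ?_⟩
    · intro x hx y hy hxy
      have hx' : x ∈ Ex := hx
      have hy' : y ∈ Ex := hy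
      simpa [hx', hy', Fin.val_inj] using hxy
    · intro x hx
      simp [hx]
  set E := Ex.card with hE
  set X : ℕ → ℝ := fun w => ∑ x ∈ Ex.filter (fun x => own x + o = w), (a + idx x * d) with hXdef
  have hX : ∀ w, 0 ≤ X w := fun w => Finset.sum_nonneg fun x _ => by positivity
  have hXW : ∀ w ∉ W, X w = 0 := by
    intro w hw
    refine Finset.sum_eq_zero fun x hx => ?_
    exact absurd (Finset.mem_image.2 ⟨x, Finset.mem_univ _, (Finset.mem_filter.1 hx).2⟩) hw
  set Q := E + (h + 1 + W.card) with hQ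
  obtain ⟨A, C, hA, hC, hAC, hAlt, hClt, hinj⟩ := exists_injective_placement h W X hX hXW
    (a := a + E * d) (d := d) (β := a + ((Q : ℝ) - o) * d) (by positivity) hd
  set c : ℕ → ℕ := fun i => if (i + o) % 2 = 0 then Q + (i + o) / 2 - o else E + A ((i + o) / 2)
    with hc
  set g : M → ℕ := fun x => if rep x = x then E + C (own x + o) else idx x with hg
  have hcz : ∀ i, a + c i * d =
      zigzag (a + E * d) d (a + ((Q : ℝ) - o) * d) A (i + o) := by
    intro i
    simp only [hc, zigzag]
    split_ifs with h0
    · rw [Nat.cast_sub (by omega)]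
      push_cast
      ring
    · push_cast
      ring
  have hgQ : ∀ x, g x < Q := by
    intro x
    simp only [hg]
    split_ifs with hx
    · have := hClt (own x + o) (Finset.mem_image_of_mem _ (Finset.mem_univ _))
      omega
    · have := hidxlt x (by simp [hEx, hx])
      omega
  have hcodd : ∀ i ≤ k, (i + o) % 2 ≠ 0 → c i < Q := by
    intro i hi h0
    simp only [hc, if_neg h0]
    have := hAlt ((i + o) / 2) (by omega)
    omega
  have hcQ : ∀ i ≤ k, (i + o) % 2 = 0 → c i = Q + (i + o) / 2 - o := by
    intro i hi h0
    simp only [hc, if_pos h0]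
  set S : ℕ → ℝ := fun i => (a + c i * d) + (a + c (i + 1) * d) +
        ∑ x ∈ Finset.univ.filter (fun x => own x = i), (a + g x * d) with hS
  have hSQ : ∀ i < k, ∀ n ≤ Q, S i ≠ a + n * d := by
    intro i hi n hn
    have h1 : 0 ≤ ∑ x ∈ Finset.univ.filter (fun x => own x = i), (a + g x * d) :=
      Finset.sum_nonneg fun x _ => by positivity
    have h2 : Q ≤ c i + c (i + 1) := by
      rcases Nat.mod_two_eq_zero_or_one (i + o) with h0 | h0
      · have := hcQ i (by omega) h0
        omega
      · have := hcQ (i + 1) (by omega) (by omega)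
        omega
    have h3 : (n : ℝ) ≤ c i + c (i + 1) := by exact_mod_cast hn.trans h2
    simp only [hS]
    nlinarith
  have hSz : ∀ i, S i = zigzag (a + E * d) d (a + ((Q : ℝ) - o) * d) A (i + o) +
      zigzag (a + E * d) d (a + ((Q : ℝ) - o) * d) A (i + o + 1) + X (i + o) +
      if i + o ∈ W then a + E * d + C (i + o) * d else 0 := by
    intro i
    simp only [hS]
    rw [hcz, hcz, show i + 1 + o = i + o + 1 by ring, add_assoc _ (X (i + o))]
    congr 1
    rw [← Finset.sum_filter_add_sum_filter_not _ (fun x => rep x ≠ x)]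
    congr 1
    · simp only [hXdef]
      refine Finset.sum_congr ?_ fun x hx => ?_
      · ext x
        simp [hEx, and_comm]
      · simp only [hEx, Finset.mem_filter] at hx
        simp only [hg, if_neg hx.1.2]
    · split_ifs with hiW
      · obtain ⟨y, -, hy⟩ := Finset.mem_image.1 hiW
        have hyi : own y = i := by omega
        rw [Finset.sum_eq_single_of_mem (rep y)]
        · simp only [hg, hrep' _ _ (hrep y), if_true, hrep, hyi]
          push_cast
          ring
        · simp [hrep, hyi, hrep' _ _ (hrep y)]
        · intro x hx hne
          simp only [Finset.mem_filter, not_not] at hx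
          exact absurd (hx.2.symm.trans (hrep' _ _ (hx.1.2.trans hyi.symm))) hne
      · refine Finset.sum_eq_zero fun x hx => absurd ?_ hiW
        simp only [Finset.mem_filter] at hx
        exact Finset.mem_image.2 ⟨x, Finset.mem_univ _, by omega⟩
  refine ⟨c, g, S, ?_, ?_, ?_, ?_, ?_, fun i => rfl, ?_, ?_, ?_, ?_⟩
  · intro i hi j hj hij
    by_cases hi0 : (i + o) % 2 = 0 <;> by_cases hj0 : (j + o) % 2 = 0
    · rw [hcQ i hi hi0, hcQ j hj hj0] at hij
      omega
    · have := hcodd j hj hj0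
      rw [← hij, hcQ i hi hi0] at this
      omega
    · have := hcodd i hi hi0
      rw [hij, hcQ j hj hj0] at this
      omega
    · simp only [hc, if_neg hi0, if_neg hj0] at hij
      have := hA.injective (Nat.add_left_cancel hij)
      omega
  · intro x y hxy
    simp only [hg] at hxy
    have hmem : ∀ x, own x + o ∈ W := fun x => Finset.mem_image_of_mem _ (Finset.mem_univ _)
    split_ifs at hxy with hx hy hy
    · have := hC (hmem x) (hmem y) (Nat.add_left_cancel hxy)
      rw [← hx, ← hy]
      exact hrep' _ _ (by omega)
    · have := hidxlt y (by simp [hEx, hy])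
      omega
    · have := hidxlt x (by simp [hEx, hx])
      omega
    · exact hidx (by simp [hEx, hx]) (by simp [hEx, hy]) hxy
  · intro i hi x hix
    by_cases hi0 : (i + o) % 2 = 0
    · have := hcQ i hi hi0
      have := hgQ x
      omega
    · simp only [hc, hg, if_neg hi0] at hix
      split_ifs at hix with hx
      · exact hAC _ (by omega) _ (Finset.mem_image_of_mem _ (Finset.mem_univ x))
          (Nat.add_left_cancel hix)
      · have := hidxlt x (by simp [hEx, hx])
        omega
  · intro i hi
    by_cases hi0 : (i + o) % 2 = 0
    · have := hcQ i hi hi0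
      omega
    · have := hcodd i hi hi0
      omega
  · intro x
    have := hgQ x
    omega
  · intro i hi j hj hij
    rw [hSz, hSz] at hij
    have := hinj (i + o) (by omega) (j + o) (by omega) hij
    omega
  · exact fun i hi x => hSQ i hi _ (hgQ x).le
  · refine fun i hi => hSQ i hi _ ?_
    by_cases h0 : (0 + o) % 2 = 0
    · have := hcQ 0 (by omega) h0
      omega
    · exact (hcodd 0 (by omega) h0).le
  · exact fun i hi => hSQ i hi _ (hcodd k le_rfl (by omega)).le

theorem SimpleGraph.eq_or_eq_of_adj_of_degree_eq_one {V : Type*} [Fintype V] {G : SimpleGraph V}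
    (hG : G.Connected) {u v : V} (huv : G.Adj u v) (hu : G.degree u = 1) (hv : G.degree v = 1)
    (z : V) : z = u ∨ z = v := by
  obtain ⟨u', -, hu'⟩ := SimpleGraph.degree_eq_one_iff_existsUnique_adj.1 hu
  obtain ⟨v', -, hv'⟩ := SimpleGraph.degree_eq_one_iff_existsUnique_adj.1 hv
  have hstep : ∀ x y, G.Adj x y → (x = u ∨ x = v) → (y = u ∨ y = v) := by
    rintro x y hxy (rfl | rfl)
    · exact Or.inr ((hu' _ hxy).trans (hu' _ huv).symm)
    · exact Or.inl ((hv' _ hxy).trans (hv' _ huv.symm).symm)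
  obtain ⟨p⟩ := hG.preconnected u z
  have : ∀ {x y : V} (_ : G.Walk x y), (x = u ∨ x = v) → (y = u ∨ y = v) := by
    intro x y q
    induction q with
    | nil => exact id
    | cons hadj _ ih => exact fun hx => ih (hstep _ _ hadj hx)
  exact this p (Or.inl rfl)

theorem not_adj_of_degree_eq_one {V : Type*} [Fintype V] {G : SimpleGraph V}
    (hG : G.Connected) (hm : 3 ≤ (edgeFS G).card) {u v : V} (hu : G.degree u = 1)
    (hv : G.degree v = 1) : ¬ G.Adj u v := by
  intro huv
  have hall := SimpleGraph.eq_or_eq_of_adj_of_degree_eq_one hG huv hu hv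
  have hsub : edgeFS G ⊆ {s(u, v)} := by
    intro e he
    induction e with
    | _ x y =>
      have hxy : G.Adj x y := by simpa [edgeFS] using he
      rcases hall x with rfl | rfl <;> rcases hall y with rfl | rfl <;>
        simp_all [Sym2.eq_swap]
  have := Finset.card_le_card hsub
  rw [Finset.card_singleton] at this
  omega

/-- A caterpillar consists of a path `w 0, …, w (k + 1)` with `k ≥ 1` and of pendant edges, the one
at a vertex `l` off the path ending in the inner vertex `w (own l + 1)` of the path. -/
theorem IsCaterpillar.exists_path {V : Type*} [Fintype V] {T : SimpleGraph V}
    (hT : IsCaterpillar T) (hm : 3 ≤ (edgeFS T).card) :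
    ∃ (k : ℕ) (w : ℕ → V) (own : V → ℕ), 1 ≤ k ∧
      (∀ i ≤ k + 1, ∀ j ≤ k + 1, w i = w j → i = j) ∧
      (∀ l, (∀ i ≤ k + 1, w i ≠ l) → own l < k) ∧
      ∀ e, e ∈ edgeFS T ↔ (∃ i ≤ k, e = s(w i, w (i + 1))) ∨
        ∃ l, (∀ i ≤ k + 1, w i ≠ l) ∧ e = s(l, w (own l + 1)) := by
  obtain ⟨hTree, k, ⟨f⟩⟩ := hT
  have hconn := hTree.connected
  have hnadj : ∀ {u v}, T.degree u = 1 → T.degree v = 1 → ¬ T.Adj u v :=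
    fun hu hv => not_adj_of_degree_eq_one hconn hm hu hv
  obtain ⟨e₀, he₀⟩ : (edgeFS T).Nonempty := Finset.card_pos.1 (by omega)
  obtain ⟨z, hz, hz'⟩ : ∃ z, T.degree z ≠ 1 ∧ Nontrivial V := by
    induction e₀ with
    | _ x y =>
      have hxy : T.Adj x y := by simpa [edgeFS] using he₀
      by_cases hx : T.degree x = 1
      · exact ⟨y, fun hy => hnadj hx hy hxy, ⟨x, y, hxy.ne⟩⟩
      · exact ⟨x, hx, ⟨x, y, hxy.ne⟩⟩
  have hdeg : ∀ x, 0 < T.degree x := fun x => hconn.preconnected.degree_pos_of_nontrivial x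
  have hk : 1 ≤ k := by
    have := (f ⟨z, hz⟩).2
    omega
  have : ∃ s : ℕ → V, (∀ i < k, T.degree (s i) ≠ 1) ∧ (∀ i < k, ∀ j < k, s i = s j → i = j) ∧
      (∀ v, T.degree v ≠ 1 → ∃ i < k, s i = v) ∧
      (∀ i < k, ∀ j < k, T.Adj (s i) (s j) ↔ i + 1 = j ∨ j + 1 = i) := by
    refine ⟨fun i => if h : i < k then (f.symm ⟨i, h⟩).1 else z, ?_, ?_, ?_, ?_⟩
    · intro i hi
      beta_reduce
      rw [dif_pos hi]
      exact (f.symm ⟨i, hi⟩).2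
    · intro i hi j hj hij
      simp only [dif_pos hi, dif_pos hj] at hij
      simpa using f.symm.injective (Subtype.ext hij)
    · intro v hv
      refine ⟨f ⟨v, hv⟩, (f ⟨v, hv⟩).2, ?_⟩
      simp
    · intro i hi j hj
      simp only [dif_pos hi, dif_pos hj]
      have := f.symm.map_adj_iff (v := ⟨i, hi⟩) (w := ⟨j, hj⟩)
      rw [SimpleGraph.pathGraph_adj] at this
      exact this
  obtain ⟨s, hs1, hsinj, hssurj, hsadj⟩ := this
  have huniq : ∀ {l x y}, T.degree l = 1 → T.Adj l x → T.Adj l y → x = y := fun hl hx hy =>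
    (SimpleGraph.degree_eq_one_iff_existsUnique_adj.1 hl).unique hx hy
  have hpar : ∀ l, ∃ i, T.degree l = 1 → i < k ∧ T.Adj l (s i) := by
    intro l
    by_cases hl : T.degree l = 1
    · obtain ⟨x, hx, -⟩ := SimpleGraph.degree_eq_one_iff_existsUnique_adj.1 hl
      obtain ⟨i, hi, rfl⟩ := hssurj x fun h => hnadj hl h hx
      exact ⟨i, fun _ => ⟨hi, hx⟩⟩
    · exact ⟨0, fun h => absurd h hl⟩
  choose own hown using hpar
  have hother : ∀ i < k, ∀ x, ∃ y, T.Adj (s i) y ∧ y ≠ x := by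
    intro i hi x
    have h2 : 1 < (T.neighborFinset (s i)).card := by
      rw [SimpleGraph.card_neighborFinset_eq_degree]
      have := hs1 i hi
      have := hdeg (s i)
      omega
    obtain ⟨y, hy, hne⟩ := Finset.exists_mem_ne h2 x
    exact ⟨y, by simpa using hy, hne⟩
  have hends : ∃ x y, x ≠ y ∧ T.degree x = 1 ∧ T.degree y = 1 ∧ T.Adj x (s 0) ∧
      T.Adj y (s (k - 1)) := by
    by_cases hk1 : k = 1
    · subst hk1
      have hleaf : ∀ y, T.Adj (s 0) y → T.degree y = 1 := by
        intro y hy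
        by_contra h
        obtain ⟨j, hj, rfl⟩ := hssurj y h
        rw [hsadj 0 hk j hj] at hy
        omega
      obtain ⟨x, hx, -⟩ := hother 0 hk (s 0)
      obtain ⟨y, hy, hne⟩ := hother 0 hk x
      exact ⟨x, y, hne.symm, hleaf x hx, hleaf y hy, hx.symm, hy.symm⟩
    · obtain ⟨x, hx, hxne⟩ := hother 0 hk (s 1)
      obtain ⟨y, hy, hyne⟩ := hother (k - 1) (by omega) (s (k - 2))
      have hxl : T.degree x = 1 := by
        by_contra h
        obtain ⟨j, hj, rfl⟩ := hssurj x h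
        rw [hsadj 0 hk j hj] at hx
        exact hxne (by congr; omega)
      have hyl : T.degree y = 1 := by
        by_contra h
        obtain ⟨j, hj, rfl⟩ := hssurj y h
        rw [hsadj (k - 1) (by omega) j hj] at hy
        exact hyne (by congr; omega)
      refine ⟨x, y, ?_, hxl, hyl, hx.symm, hy.symm⟩
      rintro rfl
      have := hsinj _ (by omega) _ (by omega) (huniq hxl hx.symm hy.symm)
      omega
  obtain ⟨x, y, hxy, hxl, hyl, hx, hy⟩ := hends
  set w : ℕ → V := fun i => if i = 0 then x else if i = k + 1 then y else s (i - 1) with hw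
  have hw0 : w 0 = x := by simp [hw]
  have hwk : w (k + 1) = y := by simp [hw]
  have hws : ∀ i < k, w (i + 1) = s i := by
    intro i hi
    have : i ≠ k := by omega
    simp [hw, this]
  have hcases : ∀ i ≤ k + 1, i = 0 ∨ i = k + 1 ∨ ∃ j < k, i = j + 1 := by
    intro i hi
    by_cases h0 : i = 0
    · exact Or.inl h0
    · by_cases h1 : i = k + 1
      · exact Or.inr (Or.inl h1)
      · exact Or.inr (Or.inr ⟨i - 1, by omega, by omega⟩)
  have hxs : ∀ i < k, s i ≠ x := fun i hi h => hs1 i hi (h ▸ hxl)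
  have hys : ∀ i < k, s i ≠ y := fun i hi h => hs1 i hi (h ▸ hyl)
  have hoff : ∀ l, (∀ i ≤ k + 1, w i ≠ l) → T.degree l = 1 := by
    intro l hl
    by_contra h
    obtain ⟨i, hi, rfl⟩ := hssurj l h
    exact hl (i + 1) (by omega) (hws i hi)
  have hleafedge : ∀ l v, T.degree l = 1 → T.Adj l v →
      (∃ i ≤ k, s(l, v) = s(w i, w (i + 1))) ∨
        ∃ l', (∀ i ≤ k + 1, w i ≠ l') ∧ s(l, v) = s(l', w (own l' + 1)) := by
    intro l v hl hlv
    by_cases hlx : l = x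
    · subst hlx
      refine Or.inl ⟨0, by omega, ?_⟩
      rw [hw0, hws 0 hk, huniq hl hlv hx]
    by_cases hly : l = y
    · subst hly
      refine Or.inl ⟨k, le_rfl, ?_⟩
      obtain ⟨j, rfl⟩ : ∃ j, k = j + 1 := ⟨k - 1, by omega⟩
      rw [hwk, hws j (by omega), huniq hl hlv hy, Sym2.eq_swap]
      rfl
    refine Or.inr ⟨l, ?_, ?_⟩
    · intro i hi
      rcases hcases i hi with rfl | rfl | ⟨j, hj, rfl⟩
      · rw [hw0]; exact Ne.symm hlx
      · rw [hwk]; exact Ne.symm hly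
      · rw [hws j hj]
        exact fun h => hs1 j hj (h ▸ hl)
    · rw [hws _ (hown l hl).1, huniq hl hlv (hown l hl).2]
  refine ⟨k, w, own, hk, ?_, fun l hl => (hown l (hoff l hl)).1, ?_⟩
  · intro i hi j hj hij
    rcases hcases i hi with rfl | rfl | ⟨i, hi', rfl⟩ <;>
      rcases hcases j hj with rfl | rfl | ⟨j, hj', rfl⟩ <;>
      try simp only [hw0, hwk] at hij
    all_goals try rw [hws i hi'] at hij
    all_goals try rw [hws j hj'] at hij
    · rfl
    · exact absurd hij hxy
    · exact absurd hij.symm (hxs j hj')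
    · exact absurd hij.symm hxy
    · rfl
    · exact absurd hij.symm (hys j hj')
    · exact absurd hij (hxs i hi')
    · exact absurd hij (hys i hi')
    · rw [hsinj i hi' j hj' hij]
  · intro e
    constructor
    · intro he
      induction e with
      | _ u v =>
        have huv : T.Adj u v := by simpa [edgeFS] using he
        by_cases hu : T.degree u = 1
        · exact hleafedge u v hu huv
        by_cases hv : T.degree v = 1
        · rw [Sym2.eq_swap]
          exact hleafedge v u hv huv.symm
        obtain ⟨i, hi, rfl⟩ := hssurj u hu
        obtain ⟨j, hj, rfl⟩ := hssurj v hv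
        rcases (hsadj i hi j hj).1 huv with rfl | rfl
        · exact Or.inl ⟨i + 1, by omega, by rw [hws i hi, hws (i + 1) hj]⟩
        · exact Or.inl ⟨j + 1, by omega, by rw [hws j hj, hws (j + 1) hi, Sym2.eq_swap]⟩
    · have hmem : ∀ u v, T.Adj u v → s(u, v) ∈ edgeFS T := by
        intro u v h
        simpa [edgeFS] using h
      rintro (⟨i, hi, rfl⟩ | ⟨l, hl, rfl⟩)
      · apply hmem
        rcases hcases i (by omega) with rfl | rfl | ⟨j, hj, rfl⟩
        · rw [hw0, hws 0 hk]
          exact hx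
        · omega
        · rcases hcases (j + 1 + 1) (by omega) with h | h | ⟨j', hj', h⟩
          · omega
          · rw [h, hwk, hws j hj, show j = k - 1 by omega]
            exact hy.symm
          · obtain rfl : j' = j + 1 := by omega
            rw [hws j hj, hws (j + 1) hj', hsadj j hj _ hj']
            exact Or.inl rfl
      · apply hmem
        have := hown l (hoff l hl)
        rw [hws _ this.1]
        exact this.2

theorem vSum_eq_sum_filter {V ι : Type*} [Fintype V] [Fintype ι] {G : SimpleGraph V}
    {ε : ι → Sym2 V} (hε : Function.Injective ε) (hG : Finset.univ.image ε = edgeFS G)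
    (φ : Sym2 V → ℝ) (v : V) :
    vSum G φ v = ∑ x ∈ Finset.univ.filter (fun x => v ∈ ε x), φ (ε x) := by
  rw [vSum, ← hG, Finset.filter_image, Finset.sum_image hε.injOn]

/-- Every caterpillar with at least three edges is arithmetic antimagic. -/
theorem stmt_16 {V : Type*} [Fintype V] (T : SimpleGraph V) (hT : IsCaterpillar T)
    (hm : 3 ≤ (edgeFS T).card) :
    ArithAntimagic T := by
  intro a d ha hd
  obtain ⟨k, w, own, hk, hw, hown, hedge⟩ := hT.exists_path hm
  let M := {l : V // ∀ i ≤ k + 1, w i ≠ l}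
  obtain ⟨c, g, S, hc, hg, hcg, hclt, hglt, hS, hSinj, hSg, hS0, hSk⟩ :=
    exists_labels hk (fun x : M => own x) ha hd
  set ε : Fin (k + 1) ⊕ M → Sym2 V :=
    Sum.elim (fun i => s(w i, w (i + 1))) (fun x => s(x.1, w (own x + 1))) with hε
  set L : Fin (k + 1) ⊕ M → ℕ := Sum.elim (fun i => c i) g with hL
  have hεinj : Function.Injective ε := by
    rintro (i | x) (j | y) hij <;> simp only [hε, Sum.elim_inl, Sum.elim_inr, Sym2.eq_iff] at hij
    · have hi := i.2
      have hj := j.2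
      rcases hij with ⟨h, -⟩ | ⟨h, h'⟩
      · exact congrArg Sum.inl (Fin.ext (hw _ (by omega) _ (by omega) h))
      · have := hw _ (by omega) _ (by omega) h
        have := hw _ (by omega) _ (by omega) h'
        omega
    · have hi := i.2
      rcases hij with ⟨h, -⟩ | ⟨-, h⟩
      · exact absurd h (y.2 _ (by omega))
      · exact absurd h (y.2 _ (by omega))
    · have hj := j.2
      rcases hij with ⟨h, -⟩ | ⟨h, -⟩
      · exact absurd h.symm (x.2 _ (by omega))
      · exact absurd h.symm (x.2 _ (by omega))
    · rcases hij with ⟨h, -⟩ | ⟨h, -⟩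
      · exact congrArg Sum.inr (Subtype.ext h)
      · have := hown y y.2
        exact absurd h.symm (x.2 _ (by omega))
  have hεimage : Finset.univ.image ε = edgeFS T := by
    ext e
    rw [hedge, Finset.mem_image]
    constructor
    · rintro ⟨i | x, -, rfl⟩
      · exact Or.inl ⟨i, by have := i.2; omega, rfl⟩
      · exact Or.inr ⟨x, x.2, rfl⟩
    · rintro (⟨i, hi, rfl⟩ | ⟨l, hl, rfl⟩)
      · exact ⟨Sum.inl ⟨i, by omega⟩, Finset.mem_univ _, rfl⟩
      · exact ⟨Sum.inr ⟨l, hl⟩, Finset.mem_univ _, rfl⟩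
  have hcard : (edgeFS T).card = k + 1 + Fintype.card M := by
    rw [← hεimage, Finset.card_image_of_injective _ hεinj, Finset.card_univ, Fintype.card_sum,
      Fintype.card_fin]
  have hLinj : Function.Injective L := by
    rintro (i | x) (j | y) hij <;> simp only [hL, Sum.elim_inl, Sum.elim_inr] at hij
    · exact congrArg Sum.inl (Fin.ext (hc _ (by omega) _ (by omega) hij))
    · exact absurd hij (hcg _ (by omega) _)
    · exact absurd hij.symm (hcg _ (by omega) _)
    · exact congrArg Sum.inr (hg hij)
  have hLimage : Finset.univ.image L = Finset.range (edgeFS T).card := by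
    refine Finset.eq_of_subset_of_card_le (fun n hn => ?_) ?_
    · obtain ⟨i | x, -, rfl⟩ := Finset.mem_image.1 hn
      · rw [Finset.mem_range, hcard]
        exact hclt _ (by omega)
      · rw [Finset.mem_range, hcard]
        exact hglt x
    · rw [Finset.card_image_of_injective _ hLinj, Finset.card_range, hcard, Finset.card_univ,
        Fintype.card_sum, Fintype.card_fin]
  have hval : ∀ {m n : ℕ}, a + m * d = a + n * d → m = n := by
    intro m n h
    exact_mod_cast mul_right_cancel₀ hd.ne' (add_left_cancel h)
  set φ : Sym2 V → ℝ := Function.extend ε (fun x => a + L x * d) 0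
  have hφ : ∀ x, φ (ε x) = a + L x * d := fun x => hεinj.extend_apply _ _ _
  refine ⟨φ, ⟨?_, ?_, ?_⟩, ?_⟩
  · rw [← hLimage, ← hεimage, Finset.coe_image, Finset.coe_image, Finset.coe_image]
    rintro _ ⟨x, -, rfl⟩
    exact ⟨L x, ⟨x, by simp, rfl⟩, (hφ x).symm⟩
  · rw [← hεimage, Finset.coe_image]
    rintro _ ⟨x, -, rfl⟩ _ ⟨y, -, rfl⟩ hxy
    rw [hφ, hφ] at hxy
    rw [hLinj (hval hxy)]
  · rw [← hLimage, ← hεimage, Finset.coe_image, Finset.coe_image, Finset.coe_image]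
    rintro _ ⟨_, ⟨x, -, rfl⟩, rfl⟩
    exact ⟨ε x, ⟨x, by simp, rfl⟩, hφ x⟩
  have hsum : ∀ v, vSum T φ v =
      ∑ i ∈ (Finset.range (k + 1)).filter (fun i => v ∈ s(w i, w (i + 1))), (a + c i * d) +
      ∑ x ∈ Finset.univ.filter (fun x : M => v ∈ s(x.1, w (own x + 1))), (a + g x * d) := by
    intro v
    rw [vSum_eq_sum_filter hεinj hεimage, Finset.sum_filter, Fintype.sum_sum_type,
      Finset.sum_filter, Finset.sum_range, Finset.sum_filter]
    simp only [hφ]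
    rfl
  have hmem : ∀ j ≤ k + 1, ∀ i ≤ k, w j ∈ s(w i, w (i + 1)) ↔ j = i ∨ j = i + 1 := by
    intro j hj i hi
    rw [Sym2.mem_iff]
    refine or_congr ⟨hw _ hj _ (by omega), ?_⟩ ⟨hw _ hj _ (by omega), ?_⟩ <;> rintro rfl <;> rfl
  have hmem' : ∀ j ≤ k + 1, ∀ x : M, w j ∈ s(x.1, w (own x + 1)) ↔ j = own x + 1 := by
    intro j hj x
    have := hown x x.2
    rw [Sym2.mem_iff, or_iff_right (x.2 j hj)]
    exact ⟨hw _ hj _ (by omega), fun h => by rw [h]⟩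
  have hend : ∀ j ≤ k + 1, j = 0 ∨ j = k + 1 → ∀ i ≤ k, (∀ n ≤ k, j = n ∨ j = n + 1 ↔ n = i) →
      vSum T φ (w j) = a + c i * d := by
    intro j hj hj' i hi hji
    rw [hsum, Finset.sum_eq_single_of_mem i, Finset.sum_eq_zero, add_zero]
    · intro x hx
      have := (hmem' j hj x).1 (Finset.mem_filter.1 hx).2
      have := hown x x.2
      omega
    · rw [Finset.mem_filter, Finset.mem_range, hmem j hj i hi, hji i hi]
      exact ⟨by omega, rfl⟩
    · intro n hn hne
      rw [Finset.mem_filter, Finset.mem_range] at hn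
      exact absurd ((hji n (by omega)).1 ((hmem j hj n (by omega)).1 hn.2)) hne
  have hsum0 : vSum T φ (w 0) = a + c 0 * d :=
    hend 0 (by omega) (by omega) 0 (by omega) (by omega)
  have hsumk : vSum T φ (w (k + 1)) = a + c k * d :=
    hend (k + 1) le_rfl (by omega) k le_rfl (by omega)
  have hsumS : ∀ i < k, vSum T φ (w (i + 1)) = S i := by
    intro i hi
    rw [hsum, hS]
    congr 1
    · rw [← Finset.sum_pair (f := fun n => a + c n * d) (Nat.lt_succ_self i).ne]
      refine Finset.sum_congr ?_ fun _ _ => rfl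
      ext n
      rw [Finset.mem_filter, Finset.mem_range, Finset.mem_insert, Finset.mem_singleton]
      refine ⟨fun h => ?_, fun h => ⟨by omega, (hmem _ (by omega) n (by omega)).2 (by omega)⟩⟩
      have := (hmem _ (by omega) n (by omega)).1 h.2
      omega
    · refine Finset.sum_congr (Finset.filter_congr fun x _ => ?_) fun _ _ => rfl
      rw [hmem' _ (by omega)]
      omega
  have hsumM : ∀ x : M, vSum T φ x = a + g x * d := by
    intro x
    rw [hsum, Finset.sum_eq_zero, zero_add, Finset.sum_eq_single_of_mem x]
    · simp
    · intro y hy hne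
      have := hown y y.2
      rcases Sym2.mem_iff.1 (Finset.mem_filter.1 hy).2 with h | h
      · exact absurd (Subtype.ext h.symm) hne
      · exact absurd h.symm (x.2 _ (by omega))
    · intro i hi
      rw [Finset.mem_filter, Finset.mem_range, Sym2.mem_iff] at hi
      rcases hi.2 with h | h
      · exact absurd h.symm (x.2 _ (by omega))
      · exact absurd h.symm (x.2 _ (by omega))
  have hcases : ∀ v, v = w 0 ∨ v = w (k + 1) ∨ (∃ i < k, v = w (i + 1)) ∨ ∃ x : M, v = x := by
    intro v
    by_cases hv : ∀ i ≤ k + 1, w i ≠ v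
    · exact Or.inr (Or.inr (Or.inr ⟨⟨v, hv⟩, rfl⟩))
    · push Not at hv
      obtain ⟨i, hi, rfl⟩ := hv
      rcases i with - | i
      · exact Or.inl rfl
      · rcases Nat.lt_or_ge i k with h | h
        · exact Or.inr (Or.inr (Or.inl ⟨i, h, rfl⟩))
        · obtain rfl : i = k := by omega
          exact Or.inr (Or.inl rfl)
  have h0k : c 0 ≠ c k := fun h => by
    have := hc 0 (by omega) k le_rfl h
    omega
  intro u v huv
  rcases hcases u with rfl | rfl | ⟨i, hi, rfl⟩ | ⟨x, rfl⟩ <;>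
    rcases hcases v with rfl | rfl | ⟨j, hj, rfl⟩ | ⟨y, rfl⟩
  · rfl
  · rw [hsum0, hsumk] at huv
    exact absurd (hval huv) h0k
  · rw [hsum0, hsumS j hj] at huv
    exact absurd huv.symm (hS0 j hj)
  · rw [hsum0, hsumM] at huv
    exact absurd (hval huv) (hcg 0 (by omega) y)
  · rw [hsum0, hsumk] at huv
    exact absurd (hval huv).symm h0k
  · rfl
  · rw [hsumk, hsumS j hj] at huv
    exact absurd huv.symm (hSk j hj)
  · rw [hsumk, hsumM] at huv
    exact absurd (hval huv) (hcg k le_rfl y)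
  · rw [hsum0, hsumS i hi] at huv
    exact absurd huv (hS0 i hi)
  · rw [hsumk, hsumS i hi] at huv
    exact absurd huv (hSk i hi)
  · rw [hsumS i hi, hsumS j hj] at huv
    rw [hSinj i hi j hj huv]
  · rw [hsumS i hi, hsumM] at huv
    exact absurd huv (hSg i hi y)
  · rw [hsum0, hsumM] at huv
    exact absurd (hval huv).symm (hcg 0 (by omega) x)
  · rw [hsumk, hsumM] at huv
    exact absurd (hval huv).symm (hcg k le_rfl x)
  · rw [hsumM, hsumS j hj] at huv
    exact absurd huv.symm (hSg j hj x)
  · rw [hsumM, hsumM] at huv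
    rw [hg (hval huv)]
end
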